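/- Suppose g is not of type A_{2p}. Let σ_K be the involution of g corresponding to the Z₂-grading g = g₀ ⊕ g₁ with g₀ = t ⊕ (⊕_{γ(x_K) even} g_γ) and g₁ = ⊕_{γ(x_K) odd} g_γ. Then dim g₀ = dim b − #K and dim g₁ = dim u⁺ + #K, where b = t ⊕ u⁺ is the Borel subalgebra. -/

import Mathlib

open scoped RealInnerProductSpace

attribute [local instance] Classical.propDecidable

section RootCombinatorics

variable {V : Type*} [NormedAddCommGroup V] [InnerProductSpace ℝ V]

/-- The Cartan pairing `⟨γ, α∨⟩ = 2 (γ, α) / (α, α)`. -/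
noncomputable def cartanPairing (γ α : V) : ℝ := 2 * ⟪γ, α⟫ / ⟪α, α⟫

/-- The coroot `γ∨ = 2 γ / (γ, γ)`. -/
noncomputable def covec (γ : V) : V := (2 / ⟪γ, γ⟫) • γ

/-- The cascade element `x_K = Σ_{β ∈ K} β / (β, β) = ½ Σ_{β ∈ K} β∨`. -/
noncomputable def cascElt (K : Finset V) : V := ∑ β ∈ K, (⟪β, β⟫)⁻¹ • β

/-- The roots of `S` orthogonal to `β`. -/
noncomputable def orthSub (S : Finset V) (β : V) : Finset V := S.filter fun γ => ⟪γ, β⟫ = 0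

/-- One step of the non-orthogonality (connectedness) relation inside `S`. -/
def connRel (S : Finset V) (a b : V) : Prop := a ∈ S ∧ b ∈ S ∧ ⟪a, b⟫ ≠ 0

/-- The irreducible component of the root subsystem `S` containing `γ`. -/
noncomputable def component (S : Finset V) (γ : V) : Finset V :=
  S.filter fun γ' => Relation.ReflTransGen (connRel S) γ γ'

/-- `C` is an irreducible component of the root subsystem `S`. -/
def IsComponent (S C : Finset V) : Prop := ∃ γ ∈ S, C = component S γ

end RootCombinatorics

/-- The combinatorial data of an irreducible crystallographic root system with a chosen
system of positive roots, base (set of simple roots) and highest root: the combinatorial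
skeleton of a finite-dimensional complex simple Lie algebra, with the Killing-form
identification of the Cartan subalgebra and its dual. -/
structure RootSystemCtx (V : Type*) [NormedAddCommGroup V] [InnerProductSpace ℝ V] where
  /-- the set of roots Δ -/
  Δ : Finset V
  /-- the set of simple roots Π -/
  base : Finset V
  /-- the set of positive roots Δ⁺ -/
  Pos : Finset V
  /-- the highest root θ -/
  θ : V
  zero_not_mem : (0 : V) ∉ Δ
  neg_mem : ∀ γ ∈ Δ, -γ ∈ Δ
  reflect_mem : ∀ α ∈ Δ, ∀ γ ∈ Δ, γ - cartanPairing γ α • α ∈ Δ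
  pairing_int : ∀ α ∈ Δ, ∀ γ ∈ Δ, ∃ k : ℤ, cartanPairing γ α = (k : ℝ)
  span_eq : Submodule.span ℝ (Δ : Set V) = ⊤
  base_subset : base ⊆ Pos
  base_indep : LinearIndependent ℝ (fun a : {x // x ∈ base} => (a : V))
  pos_subset : Pos ⊆ Δ
  pos_or_neg : ∀ γ ∈ Δ, γ ∈ Pos ∨ -γ ∈ Pos
  pos_not_neg : ∀ γ ∈ Pos, -γ ∉ Pos
  pos_coords : ∀ γ ∈ Pos, γ ∈ AddSubmonoid.closure (base : Set V)
  irreducible : ∀ S : Finset V, S ⊆ Δ → S.Nonempty →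
    (∀ a ∈ S, ∀ b ∈ Δ, b ∉ S → ⟪a, b⟫ = 0) → S = Δ
  theta_mem : θ ∈ Pos
  theta_highest : ∀ γ ∈ Δ, θ - γ ∈ AddSubmonoid.closure (base : Set V)

namespace RootSystemCtx

variable {V : Type*} [NormedAddCommGroup V] [InnerProductSpace ℝ V]

variable (ctx : RootSystemCtx V)

/-- The root order `γ ≼ γ'` on roots: `γ' - γ` is a nonnegative integral combination of
simple roots. -/
def rootLE (γ γ' : V) : Prop := γ' - γ ∈ AddSubmonoid.closure (ctx.base : Set V)

/-- `β` is the highest root of the root subsystem `S` (with respect to the ambient positive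
system). -/
def IsHighest (S : Finset V) (β : V) : Prop :=
  β ∈ S ∧ β ∈ ctx.Pos ∧ ∀ γ ∈ S, ctx.rootLE γ β

/-- `CascadeMem ctx S β` : the pair (root subsystem `S = Δ⟨i⟩`, its highest root `β = βᵢ`)
occurs in the recursive construction of the Kostant cascade: one starts with `(Δ, θ)`, and the
descendants of `(S, β)` are the pairs `(C, β')` where `C` is an irreducible component of
`{γ ∈ S | (γ, β) = 0}` and `β'` is the highest root of `C`. -/
inductive CascadeMem : Finset V → V → Prop
  | top : CascadeMem ctx.Δ ctx.θ
  | step {S C : Finset V} {β β' : V} : CascadeMem S β →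
      IsComponent (orthSub S β) C → ctx.IsHighest C β' → CascadeMem C β'

/-- `K` is the Kostant cascade of the root system. -/
def IsCascade (K : Finset V) : Prop := ∀ β, β ∈ K ↔ ∃ S, ctx.CascadeMem S β

/-- The Heisenberg subset `H_β = {γ ∈ S ∩ Δ⁺ : (γ, β) > 0}` attached to a cascade pair
`(S, β)`. -/
noncomputable def heis (S : Finset V) (β : V) : Finset V :=
  S.filter fun γ => γ ∈ ctx.Pos ∧ 0 < ⟪γ, β⟫

/-- A root is long if it has the same length as the highest root. -/
def IsLong (γ : V) : Prop := ⟪γ, γ⟫ = ⟪ctx.θ, ctx.θ⟫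

/-- The highest root `θ` is a fundamental weight. -/
def ThetaFundamental : Prop :=
  ∃ α ∈ ctx.base, cartanPairing ctx.θ α = 1 ∧
    ∀ β ∈ ctx.base, β ≠ α → cartanPairing ctx.θ β = 0

/-- `β'` is a descendant of the cascade element `β`. -/
def Desc (β β' : V) : Prop :=
  ∃ S C, ctx.CascadeMem S β ∧ IsComponent (orthSub S β) C ∧ ctx.IsHighest C β'

/-- The cascade poset order: `β ≤ β'` iff `β` is an iterated descendant of `β'`. -/
def cascLE (β β' : V) : Prop := Relation.ReflTransGen (fun a b => ctx.Desc b a) β β'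

/-- A simple reflection of the root system. -/
def IsSimpleReflection (w : V ≃ₗ[ℝ] V) : Prop :=
  ∃ α ∈ ctx.base, ∀ v, w v = v - (2 * ⟪v, α⟫ / ⟪α, α⟫) • α

/-- The Weyl group, generated by the simple reflections. -/
def weylGroup : Subgroup (V ≃ₗ[ℝ] V) := Subgroup.closure {w | ctx.IsSimpleReflection w}

/-- The length of a Weyl group element: the minimal number of simple reflections needed to
express it. -/
noncomputable def length (w : V ≃ₗ[ℝ] V) : ℕ :=
  sInf {n | ∃ l : List (V ≃ₗ[ℝ] V), l.length = n ∧
    (∀ s ∈ l, ctx.IsSimpleReflection s) ∧ l.prod = w}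

/-- The root system is of type `Aₙ` (Cartan matrix characterisation). -/
def IsTypeA (n : ℕ) : Prop :=
  1 ≤ n ∧ ∃ e : Fin n ≃ {x // x ∈ ctx.base}, ∀ i j : Fin n,
    cartanPairing (e i : V) (e j : V) =
      (if i = j then 2 else if i.val + 1 = j.val ∨ j.val + 1 = i.val then -1 else 0)

/-- The root system is of type `Bₙ` (`n ≥ 2`), with the last simple root short. -/
def IsTypeB (n : ℕ) : Prop :=
  2 ≤ n ∧ ∃ e : Fin n ≃ {x // x ∈ ctx.base}, ∀ i j : Fin n,
    cartanPairing (e i : V) (e j : V) =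
      (if i = j then 2
       else if i.val + 2 = n ∧ j.val + 1 = n then -2
       else if i.val + 1 = j.val ∨ j.val + 1 = i.val then -1 else 0)

/-- The root system is of type `Cₙ` (`n ≥ 2`), with the last simple root long. -/
def IsTypeC (n : ℕ) : Prop :=
  2 ≤ n ∧ ∃ e : Fin n ≃ {x // x ∈ ctx.base}, ∀ i j : Fin n,
    cartanPairing (e i : V) (e j : V) =
      (if i = j then 2
       else if i.val + 1 = n ∧ j.val + 2 = n then -2
       else if i.val + 1 = j.val ∨ j.val + 1 = i.val then -1 else 0)

/-- The root system is of type `G₂` (first simple root short). -/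
def IsTypeG2 : Prop :=
  ∃ e : Fin 2 ≃ {x // x ∈ ctx.base},
    cartanPairing (e 0 : V) (e 0 : V) = 2 ∧ cartanPairing (e 1 : V) (e 1 : V) = 2 ∧
    cartanPairing (e 0 : V) (e 1 : V) = -1 ∧ cartanPairing (e 1 : V) (e 0 : V) = -3

/-- The set of roots `Δ(a_z) = w(Δ⁺_z(-1)) ∪ w(-Δ⁺_z(2))` of the abelian ideal attached by
Kostant's construction to `z` (with `w = w_z`). -/
def idealSet (w : V ≃ₗ[ℝ] V) (x : V) : Set V :=
  {δ | ∃ γ ∈ ctx.Pos, (⟪γ, x⟫ = -1 ∧ δ = w γ) ∨ (⟪γ, x⟫ = 2 ∧ δ = -(w γ))}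

end RootSystemCtx

/-- A root-space decomposition of a finite-dimensional complex Lie algebra `g` compatible
with the root-system data `ctx`: a Cartan subalgebra `t`, root vectors `e γ` for `γ ∈ Δ`,
and the Killing identification `coh : V → t` of the rational/real form of the Cartan
subalgebra with the Euclidean space `V` carrying the root system. -/
structure LieRootData {V : Type*} [NormedAddCommGroup V] [InnerProductSpace ℝ V]
    (ctx : RootSystemCtx V) (g : Type*) [LieRing g] [LieAlgebra ℂ g] where
  t : LieSubalgebra ℂ g
  e : V → g
  coh : V → g
  coh_add : ∀ v w, coh (v + w) = coh v + coh w
  coh_smul : ∀ (r : ℝ) (v : V), coh (r • v) = (r : ℂ) • coh v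
  coh_inj : ∀ v, coh v = 0 → v = 0
  coh_mem : ∀ v, coh v ∈ t
  t_span : t.toSubmodule = Submodule.span ℂ (Set.range coh)
  t_abelian : ∀ x ∈ t, ∀ y ∈ t, ⁅x, y⁆ = (0 : g)
  e_ne : ∀ γ ∈ ctx.Δ, e γ ≠ 0
  bracket_coh_e : ∀ (v : V), ∀ γ ∈ ctx.Δ, ⁅coh v, e γ⁆ = (⟪γ, v⟫ : ℂ) • e γ
  bracket_e_e_root : ∀ γ ∈ ctx.Δ, ∀ δ ∈ ctx.Δ, γ + δ ∈ ctx.Δ →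
    ∃ c : ℂ, c ≠ 0 ∧ ⁅e γ, e δ⁆ = c • e (γ + δ)
  bracket_e_e_neg : ∀ γ ∈ ctx.Δ, ∃ c : ℂ, c ≠ 0 ∧ ⁅e γ, e (-γ)⁆ = c • coh γ
  bracket_e_e_zero : ∀ γ ∈ ctx.Δ, ∀ δ ∈ ctx.Δ, γ + δ ∉ ctx.Δ → γ + δ ≠ 0 → ⁅e γ, e δ⁆ = 0
  span_top : (⊤ : Submodule ℂ g) = t.toSubmodule ⊔ Submodule.span ℂ (e '' (ctx.Δ : Set V))
  dim_eq : Module.finrank ℂ g = Module.finrank ℂ ↥t + ctx.Δ.card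
  rank_eq : Module.finrank ℂ ↥t = ctx.base.card

namespace RootSystemCtx

variable {V : Type*} [NormedAddCommGroup V] [InnerProductSpace ℝ V] (ctx : RootSystemCtx V)

section Basic

variable {ctx}

lemma inner_self_pos {γ : V} (h : γ ∈ ctx.Δ) : 0 < ⟪γ, γ⟫ := by
  rw [real_inner_self_pos]
  rintro rfl
  exact ctx.zero_not_mem h

lemma cartanPairing_mul_inner {a : V} (ha : a ∈ ctx.Δ) (v : V) :
    cartanPairing v a * ⟪a, a⟫ = 2 * ⟪v, a⟫ :=
  div_mul_cancel₀ _ (inner_self_pos ha).ne'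

lemma inner_eq_zero_of_cartanPairing {a v : V} (ha : a ∈ ctx.Δ) (h : cartanPairing v a = 0) :
    ⟪v, a⟫ = 0 := by
  have := cartanPairing_mul_inner ha v
  rw [h] at this
  linarith

/-- If two distinct roots form an acute angle, their difference is a root. -/
lemma sub_mem {a b : V} (ha : a ∈ ctx.Δ) (hb : b ∈ ctx.Δ) (hab : a ≠ b) (h : 0 < ⟪a, b⟫) :
    a - b ∈ ctx.Δ := by
  have haa := inner_self_pos ha
  have hbb := inner_self_pos hb
  obtain ⟨m, hm⟩ := ctx.pairing_int b hb a ha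
  obtain ⟨n, hn⟩ := ctx.pairing_int a ha b hb
  have em := cartanPairing_mul_inner hb a
  have en := cartanPairing_mul_inner ha b
  have hba : ⟪b, a⟫ = ⟪a, b⟫ := real_inner_comm _ _
  rw [hm] at em
  rw [hn, hba] at en
  by_cases hm1 : m = 1
  · have := ctx.reflect_mem b hb a ha
    rwa [hm, hm1, Int.cast_one, one_smul] at this
  by_cases hn1 : n = 1
  · have := ctx.neg_mem _ (ctx.reflect_mem a ha b hb)
    rwa [hn, hn1, Int.cast_one, one_smul, neg_sub] at this
  have hm0 : (0 : ℝ) < m := by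
    by_contra hc
    nlinarith
  have hn0 : (0 : ℝ) < n := by
    by_contra hc
    nlinarith
  have hm2 : (2 : ℝ) ≤ m := by
    have : 0 < m := by exact_mod_cast hm0
    exact_mod_cast (by omega : 2 ≤ m)
  have hn2 : (2 : ℝ) ≤ n := by
    have : 0 < n := by exact_mod_cast hn0
    exact_mod_cast (by omega : 2 ≤ n)
  have := real_inner_self_pos.mpr (sub_ne_zero.mpr hab)
  simp only [inner_sub_left, inner_sub_right, hba] at this
  nlinarith

lemma add_mem {a b : V} (ha : a ∈ ctx.Δ) (hb : b ∈ ctx.Δ) (hab : a ≠ -b) (h : ⟪a, b⟫ < 0) :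
    a + b ∈ ctx.Δ := by
  have := sub_mem ha (ctx.neg_mem b hb) hab (by rw [inner_neg_right]; linarith)
  rwa [sub_neg_eq_add] at this

/-- For orthogonal roots, the sum is a root as soon as the difference is. -/
lemma add_mem_of_sub_mem {a b : V} (hb : b ∈ ctx.Δ) (h : ⟪a, b⟫ = 0)
    (hs : a - b ∈ ctx.Δ) : a + b ∈ ctx.Δ := by
  have := ctx.reflect_mem b hb _ hs
  have hbb := inner_self_pos hb
  have e : cartanPairing (a - b) b = -2 := by
    rw [cartanPairing, inner_sub_left, h]
    field_simp
    ring
  rw [e] at this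
  convert this using 1
  module

lemma sub_mem_of_add_mem {a b : V} (hb : b ∈ ctx.Δ) (h : ⟪a, b⟫ = 0)
    (hs : a + b ∈ ctx.Δ) : a - b ∈ ctx.Δ := by
  rw [sub_eq_add_neg]
  exact add_mem_of_sub_mem (ctx.neg_mem b hb) (by rw [inner_neg_right, h, neg_zero])
    (by rwa [sub_neg_eq_add])

variable (ctx)

lemma exists_height : ∃ f : V →ₗ[ℝ] ℝ, ∀ b ∈ ctx.base, f b = 1 := by
  let B := Module.Basis.extend ctx.base_indep.linearIndepOn_id
  refine ⟨B.constr ℝ fun _ => (1 : ℝ), fun b hb => ?_⟩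
  have hb' := ctx.base_indep.linearIndepOn_id.subset_extend (Set.subset_univ _)
    (show b ∈ Set.range (fun a : {x // x ∈ ctx.base} => (a : V)) from ⟨⟨b, hb⟩, rfl⟩)
  have := B.constr_basis ℝ (fun _ => (1 : ℝ)) ⟨b, hb'⟩
  rwa [Module.Basis.extend_apply_self] at this

/-- The height function. -/
noncomputable def height : V →ₗ[ℝ] ℝ := ctx.exists_height.choose

variable {ctx}

lemma height_base {b : V} (hb : b ∈ ctx.base) : ctx.height b = 1 :=
  ctx.exists_height.choose_spec b hb

lemma closure_cases {x : V} (hx : x ∈ AddSubmonoid.closure (ctx.base : Set V)) :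
    x = 0 ∨ x ∈ ctx.base ∨ 2 ≤ ctx.height x := by
  induction hx using AddSubmonoid.closure_induction with
  | mem x hx => exact .inr (.inl hx)
  | zero => exact .inl rfl
  | add x y _ _ hx hy =>
    rcases hx with rfl | hx
    · simpa using hy
    rcases hy with rfl | hy
    · simpa using Or.inr hx
    right; right
    have aux : ∀ z, (z ∈ ctx.base ∨ 2 ≤ ctx.height z) → 1 ≤ ctx.height z := by
      rintro z (h | h)
      · exact (height_base h).ge
      · linarith
    rw [map_add]
    linarith [aux x hx, aux y hy]

lemma one_le_height {x : V} (hx : x ∈ ctx.Pos) : 1 ≤ ctx.height x := by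
  rcases closure_cases (ctx.pos_coords x hx) with rfl | h | h
  · exact absurd (ctx.pos_subset hx) ctx.zero_not_mem
  · exact (height_base h).ge
  · linarith

lemma mem_base_of_height {x : V} (hx : x ∈ ctx.Pos) (h : ctx.height x ≤ 1) : x ∈ ctx.base := by
  rcases closure_cases (ctx.pos_coords x hx) with rfl | h' | h'
  · exact absurd (ctx.pos_subset hx) ctx.zero_not_mem
  · exact h'
  · linarith

lemma height_lt_of_rootLE {γ δ : V} (h : ctx.rootLE γ δ) (hne : γ ≠ δ) :
    ctx.height γ < ctx.height δ := by
  have e : ctx.height (δ - γ) = ctx.height δ - ctx.height γ := map_sub _ _ _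
  rcases closure_cases h with h | h | h
  · exact absurd (sub_eq_zero.mp h).symm hne
  · linarith [height_base h]
  · linarith

lemma height_le_of_rootLE {γ δ : V} (h : ctx.rootLE γ δ) : ctx.height γ ≤ ctx.height δ := by
  by_cases hne : γ = δ
  · rw [hne]
  · exact (height_lt_of_rootLE h hne).le

lemma rootLE_refl (γ : V) : ctx.rootLE γ γ := by
  simp [rootLE]

lemma rootLE_trans {a b c : V} (h : ctx.rootLE a b) (h' : ctx.rootLE b c) : ctx.rootLE a c := by
  have := AddSubmonoid.add_mem _ h h'
  rwa [rootLE, ← sub_add_sub_cancel' b a c]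

lemma rootLE_add_pos {a δ : V} (h : δ ∈ ctx.Pos) : ctx.rootLE a (a + δ) := by
  rw [rootLE, add_sub_cancel_left]
  exact ctx.pos_coords δ h

lemma not_rootLE_of_pos {a b : V} (h : b - a ∈ ctx.Pos) : ¬ ctx.rootLE b a := by
  intro h'
  have h1 := height_le_of_rootLE h'
  have h2 := one_le_height h
  rw [map_sub] at h2
  linarith

lemma base_sub_notMem {a b : V} (ha : a ∈ ctx.base) (hb : b ∈ ctx.base) : a - b ∉ ctx.Δ := by
  intro hmem
  rcases ctx.pos_or_neg _ hmem with h | h <;>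
  · have := one_le_height h
    norm_num [height_base ha, height_base hb] at this

lemma inner_base_nonpos {a b : V} (ha : a ∈ ctx.base) (hb : b ∈ ctx.base) (hab : a ≠ b) :
    ⟪a, b⟫ ≤ 0 := by
  by_contra! h
  exact base_sub_notMem ha hb (sub_mem (ctx.pos_subset (ctx.base_subset ha))
    (ctx.pos_subset (ctx.base_subset hb)) hab h)

end Basic

/-- A closed root subsystem. -/
structure IsClosedSubsystem (S : Finset V) : Prop where
  subset : S ⊆ ctx.Δ
  neg : ∀ a ∈ S, -a ∈ S
  reflect : ∀ a ∈ S, ∀ b ∈ S, b - cartanPairing b a • a ∈ S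
  add : ∀ a ∈ S, ∀ b ∈ S, a + b ∈ ctx.Δ → a + b ∈ S

section Subsystem

variable {ctx}

lemma isClosedSubsystem_roots : ctx.IsClosedSubsystem ctx.Δ :=
  ⟨subset_rfl, ctx.neg_mem, ctx.reflect_mem, fun _ _ _ _ h => h⟩

lemma IsClosedSubsystem.sub {S : Finset V} (hS : ctx.IsClosedSubsystem S) {a b : V} (ha : a ∈ S)
    (hb : b ∈ S) (h : a - b ∈ ctx.Δ) : a - b ∈ S := by
  rw [sub_eq_add_neg] at h ⊢
  exact hS.add a ha _ (hS.neg b hb) h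

lemma IsClosedSubsystem.orthSub {S : Finset V} (hS : ctx.IsClosedSubsystem S) (β : V) :
    ctx.IsClosedSubsystem (orthSub S β) := by
  constructor
  · exact (Finset.filter_subset _ _).trans hS.subset
  · intro a ha
    rw [_root_.orthSub, Finset.mem_filter] at ha ⊢
    exact ⟨hS.neg a ha.1, by rw [inner_neg_left, ha.2, neg_zero]⟩
  · intro a ha b hb
    rw [_root_.orthSub, Finset.mem_filter] at ha hb ⊢
    refine ⟨hS.reflect a ha.1 b hb.1, ?_⟩
    rw [inner_sub_left, inner_smul_left, ha.2, hb.2]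
    simp
  · intro a ha b hb h
    rw [_root_.orthSub, Finset.mem_filter] at ha hb ⊢
    exact ⟨hS.add a ha.1 b hb.1 h, by rw [inner_add_left, ha.2, hb.2, add_zero]⟩

lemma component_subset {S C : Finset V} (hC : IsComponent S C) : C ⊆ S := by
  obtain ⟨γ, -, rfl⟩ := hC
  exact Finset.filter_subset _ _

lemma component_step {S C : Finset V} (hC : IsComponent S C) {a b : V} (ha : a ∈ C) (hb : b ∈ S)
    (h : ⟪a, b⟫ ≠ 0) : b ∈ C := by
  obtain ⟨γ, -, rfl⟩ := hC
  rw [component, Finset.mem_filter] at ha ⊢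
  exact ⟨hb, ha.2.tail ⟨ha.1, hb, h⟩⟩

lemma mem_component_self {S : Finset V} {γ : V} (h : γ ∈ S) : γ ∈ component S γ := by
  rw [component, Finset.mem_filter]
  exact ⟨h, .refl⟩

lemma connRel_symm {S : Finset V} : Std.Symm (connRel S) :=
  ⟨fun a b ⟨ha, hb, h⟩ => ⟨hb, ha, by rwa [real_inner_comm]⟩⟩

lemma component_connected {S C : Finset V} (hC : IsComponent S C) {a b : V} (ha : a ∈ C)
    (hb : b ∈ C) : Relation.ReflTransGen (connRel C) a b := by
  have key : Relation.ReflTransGen (connRel S) a b := by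
    obtain ⟨γ, -, rfl⟩ := hC
    rw [component, Finset.mem_filter] at ha hb
    have := connRel_symm (S := S)
    exact (Std.Symm.symm _ _ ha.2 : Relation.ReflTransGen (connRel S) a γ).trans hb.2
  clear hb
  suffices b ∈ C ∧ Relation.ReflTransGen (connRel C) a b from this.2
  induction key with
  | refl => exact ⟨ha, .refl⟩
  | tail _ h ih =>
    have := component_step hC ih.1 h.2.1 h.2.2
    exact ⟨this, ih.2.tail ⟨ih.1, this, h.2.2⟩⟩

lemma subset_of_connected {S C D : Finset V} (hC : IsComponent S C) {a : V} (ha : a ∈ C)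
    (haD : a ∈ D) (hDS : D ⊆ S)
    (hD : ∀ x ∈ D, ∀ y ∈ D, Relation.ReflTransGen (connRel D) x y) : D ⊆ C := by
  intro b hb
  have := hD a haD b hb
  clear hb
  induction this with
  | refl => exact ha
  | tail _ h ih => exact component_step hC ih (hDS h.2.1) h.2.2

lemma IsClosedSubsystem.component {S C : Finset V} (hS : ctx.IsClosedSubsystem S)
    (hC : IsComponent S C) : ctx.IsClosedSubsystem C := by
  have hCS := component_subset hC
  constructor
  · exact hCS.trans hS.subset
  · intro a ha
    refine component_step hC ha (hS.neg a (hCS ha)) ?_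
    rw [inner_neg_right]
    exact (neg_lt_zero.mpr (inner_self_pos (hS.subset (hCS ha)))).ne
  · intro a ha b hb
    by_cases h : ⟪b, a⟫ = 0
    · simpa [cartanPairing, h] using hb
    · refine component_step hC ha (hS.reflect a (hCS ha) b (hCS hb)) ?_
      have := cartanPairing_mul_inner (hS.subset (hCS ha)) b
      rw [inner_sub_right, inner_smul_right, this, real_inner_comm]
      intro h'
      exact h (by linarith)
  · intro a ha b hb h
    have hm := hS.add a (hCS ha) b (hCS hb) h
    by_cases h1 : ⟪a, a + b⟫ = 0
    · by_cases h2 : ⟪b, a + b⟫ = 0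
      · have := inner_self_pos h
        rw [inner_add_left, h1, h2] at this
        simp at this
      · exact component_step hC hb hm h2
    · exact component_step hC ha hm h1

/-- Two roots in a connected closed subsystem have a common non-orthogonal root. -/
lemma exists_inner_ne_zero {C : Finset V} (hC : ctx.IsClosedSubsystem C) {a b : V} (ha : a ∈ C)
    (h : Relation.ReflTransGen (connRel C) a b) : ∃ c ∈ C, ⟪c, a⟫ ≠ 0 ∧ ⟪c, b⟫ ≠ 0 := by
  induction h with
  | refl => exact ⟨a, ha, (inner_self_pos (hC.subset ha)).ne', (inner_self_pos (hC.subset ha)).ne'⟩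
  | @tail b d _ h ih =>
    obtain ⟨c, hc, hca, hcb⟩ := ih
    obtain ⟨hb, hd, hbd⟩ := h
    by_cases h1 : ⟪c, d⟫ = 0
    · by_cases h2 : ⟪b, a⟫ = 0
      · refine ⟨_, hC.reflect b hb c hc, ?_, ?_⟩
        · rwa [inner_sub_left, inner_smul_left, h2, mul_zero, sub_zero]
        · rw [inner_sub_left, inner_smul_left, h1, zero_sub, neg_ne_zero]
          refine mul_ne_zero ?_ hbd
          exact fun h0 => hcb (inner_eq_zero_of_cartanPairing (hC.subset hb) h0)
      · exact ⟨b, hb, h2, hbd⟩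
    · exact ⟨c, hc, hca, h1⟩

/-- An irreducible closed subsystem has a highest root. -/
lemma exists_isHighest {C : Finset V} (hC : ctx.IsClosedSubsystem C) (hne : C.Nonempty)
    (hconn : ∀ x ∈ C, ∀ y ∈ C, Relation.ReflTransGen (connRel C) x y) :
    ∃ β, ctx.IsHighest C β := by
  have pos_of_max : ∀ μ ∈ C, (∀ δ ∈ C, ctx.rootLE μ δ → δ = μ) → μ ∈ ctx.Pos := by
    intro μ hμ hmax
    rcases ctx.pos_or_neg μ (hC.subset hμ) with h | h
    · exact h
    · have := hmax (-μ) (hC.neg μ hμ) (by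
        rw [rootLE, sub_eq_add_neg]
        exact AddSubmonoid.add_mem _ (ctx.pos_coords _ h) (ctx.pos_coords _ h))
      rwa [this] at h
  have dom_of_max : ∀ μ ∈ C, (∀ δ ∈ C, ctx.rootLE μ δ → δ = μ) →
      ∀ δ ∈ C, δ ∈ ctx.Pos → 0 ≤ ⟪δ, μ⟫ := by
    intro μ hμ hmax δ hδ hδp
    by_contra! hlt
    have hm := add_mem (hC.subset hμ) (hC.subset hδ)
      (fun h => ctx.pos_not_neg δ hδp (h ▸ pos_of_max μ hμ hmax)) (by rwa [real_inner_comm])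
    have := hmax _ (hC.add _ hμ _ hδ hm) (rootLE_add_pos hδp)
    rw [add_eq_left] at this
    exact ctx.zero_not_mem (this ▸ hC.subset hδ)
  have unique : ∀ μ ∈ C, (∀ δ ∈ C, ctx.rootLE μ δ → δ = μ) →
      ∀ ν ∈ C, (∀ δ ∈ C, ctx.rootLE ν δ → δ = ν) → μ = ν := by
    intro μ hμ hμm ν hν hνm
    by_contra hne
    have hμp := pos_of_max μ hμ hμm
    have hcmp : ∀ γ ∈ C, γ - μ ∉ ctx.Pos := by
      intro γ hγ hp
      have := hμm γ hγ (ctx.pos_coords _ hp)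
      rw [this, sub_self] at hp
      exact ctx.zero_not_mem (ctx.pos_subset hp)
    have horth : ⟪μ, ν⟫ = 0 := by
      refine le_antisymm ?_ (dom_of_max ν hν hνm μ hμ hμp)
      by_contra! hlt
      have hm := sub_mem (hC.subset hμ) (hC.subset hν) hne hlt
      rcases ctx.pos_or_neg _ hm with h | h
      · exact hne (hνm μ hμ (ctx.pos_coords _ h))
      · rw [neg_sub] at h
        exact hcmp ν hν h
    obtain ⟨c, hc, hcp, hcμ, hcν⟩ : ∃ c ∈ C, c ∈ ctx.Pos ∧ ⟪c, μ⟫ ≠ 0 ∧ ⟪c, ν⟫ ≠ 0 := by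
      obtain ⟨c, hc, h1, h2⟩ := exists_inner_ne_zero hC hμ (hconn μ hμ ν hν)
      rcases ctx.pos_or_neg c (hC.subset hc) with h | h
      · exact ⟨c, hc, h, h1, h2⟩
      · exact ⟨-c, hC.neg c hc, h, by rwa [inner_neg_left, neg_ne_zero],
          by rwa [inner_neg_left, neg_ne_zero]⟩
    have hcμ' := lt_of_le_of_ne (dom_of_max μ hμ hμm c hc hcp) hcμ.symm
    have hcν' := lt_of_le_of_ne (dom_of_max ν hν hνm c hc hcp) hcν.symm
    have hm := sub_mem (hC.subset hμ) (hC.subset hc) (by rintro rfl; exact hcν horth)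
      (by rwa [real_inner_comm])
    rcases ctx.pos_or_neg _ hm with h | h
    · have := dom_of_max ν hν hνm _ (hC.sub hμ hc hm) h
      rw [inner_sub_left, horth] at this
      linarith
    · rw [neg_sub] at h
      exact hcmp c hc h
  have exists_max : ∀ γ ∈ C, ∃ μ ∈ C, ctx.rootLE γ μ ∧ ∀ δ ∈ C, ctx.rootLE μ δ → δ = μ := by
    intro γ hγ
    obtain ⟨μ, hμ, hmax⟩ := (C.filter fun δ => ctx.rootLE γ δ).exists_max_image ctx.height
      ⟨γ, by simp [hγ, rootLE_refl]⟩
    rw [Finset.mem_filter] at hμ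
    refine ⟨μ, hμ.1, hμ.2, fun δ hδ hle => ?_⟩
    by_contra hne
    have h1 := hmax δ (by simp [hδ, rootLE_trans hμ.2 hle])
    have h2 := height_lt_of_rootLE hle (Ne.symm hne)
    linarith
  obtain ⟨γ, hγ⟩ := hne
  obtain ⟨μ, hμ, -, hmax⟩ := exists_max γ hγ
  refine ⟨μ, hμ, pos_of_max μ hμ hmax, fun δ hδ => ?_⟩
  obtain ⟨ν, hν, hle, hνm⟩ := exists_max δ hδ
  rwa [unique μ hμ hmax ν hν hνm]

lemma isHighest_unique {S : Finset V} {β β' : V} (h : ctx.IsHighest S β)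
    (h' : ctx.IsHighest S β') : β = β' := by
  by_contra hne
  have h1 := height_lt_of_rootLE (h.2.2 β' h'.1) (Ne.symm hne)
  have h2 := height_lt_of_rootLE (h'.2.2 β h.1) hne
  linarith

lemma IsHighest.inner_nonneg {S : Finset V} (hS : ctx.IsClosedSubsystem S) {β γ : V}
    (h : ctx.IsHighest S β) (hγ : γ ∈ S) (hp : γ ∈ ctx.Pos) : 0 ≤ ⟪γ, β⟫ := by
  by_contra! hlt
  have hm := add_mem (hS.subset h.1) (hS.subset hγ)
    (fun e => ctx.pos_not_neg γ hp (e ▸ h.2.1)) (by rwa [real_inner_comm])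
  exact not_rootLE_of_pos (by rwa [add_sub_cancel_left]) (h.2.2 _ (hS.add _ h.1 _ hγ hm))

lemma IsHighest.add_notMem {S : Finset V} (hS : ctx.IsClosedSubsystem S) {β γ : V}
    (h : ctx.IsHighest S β) (hγ : γ ∈ S) (horth : ⟪γ, β⟫ = 0) : β + γ ∉ ctx.Δ := by
  intro hm
  rcases ctx.pos_or_neg γ (hS.subset hγ) with hp | hp
  · exact not_rootLE_of_pos (by rwa [add_sub_cancel_left]) (h.2.2 _ (hS.add _ h.1 _ hγ hm))
  · have hm' := sub_mem_of_add_mem (hS.subset hγ) (by rwa [real_inner_comm]) hm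
    exact not_rootLE_of_pos (by rwa [sub_sub_cancel_left]) (h.2.2 _ (hS.sub h.1 hγ hm'))

end Subsystem

section Cascade

variable {ctx}

lemma cascadeMem_spec {S : Finset V} {β : V} (h : ctx.CascadeMem S β) :
    ctx.IsClosedSubsystem S ∧ ctx.IsHighest S β := by
  induction h with
  | top => exact ⟨isClosedSubsystem_roots, ctx.pos_subset ctx.theta_mem, ctx.theta_mem,
      ctx.theta_highest⟩
  | step _ hC hβ ih => exact ⟨(ih.1.orthSub _).component hC, hβ⟩

lemma orthSub_subset (S : Finset V) (β : V) : orthSub S β ⊆ S := Finset.filter_subset _ _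

lemma mem_orthSub {S : Finset V} {β γ : V} : γ ∈ orthSub S β ↔ γ ∈ S ∧ ⟪γ, β⟫ = 0 :=
  Finset.mem_filter

/-- Two members of the cascade are equal, nested or strongly orthogonal. -/
lemma cascadeMem_trichotomy {S S' : Finset V} {β β' : V} (h : ctx.CascadeMem S β)
    (h' : ctx.CascadeMem S' β') :
    (S = S' ∧ β = β') ∨ S' ⊆ orthSub S β ∨ S ⊆ orthSub S' β' ∨
      ∀ a ∈ S, ∀ b ∈ S', ⟪a, b⟫ = 0 ∧ a + b ∉ ctx.Δ := by
  have top : ∀ {S' : Finset V} {β' : V}, ctx.CascadeMem S' β' →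
      (ctx.Δ = S' ∧ ctx.θ = β') ∨ S' ⊆ orthSub ctx.Δ ctx.θ := by
    intro S' β' h'
    induction h' with
    | top => exact .inl ⟨rfl, rfl⟩
    | step _ hC _ ih =>
      right
      rcases ih with ⟨rfl, rfl⟩ | ih
      · exact component_subset hC
      · exact (component_subset hC).trans ((orthSub_subset _ _).trans ih)
  induction h generalizing S' β' with
  | top =>
    rcases top h' with h | h
    · exact .inl h
    · exact .inr (.inl h)
  | @step S C β β₁ hS hC hβ₁ ih =>
    have hCS := (component_subset hC).trans (orthSub_subset _ _)
    have hcl := ((cascadeMem_spec hS).1.orthSub β).component hC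
    induction h' with
    | top =>
      rcases top (.step hS hC hβ₁) with h | h
      · exact .inl ⟨h.1.symm, h.2.symm⟩
      · exact .inr (.inr (.inl h))
    | @step S' C' β' β₁' hS' hC' hβ₁' ih' =>
      have hcs' := ((cascadeMem_spec hS').1.orthSub β').component hC'
      have hCS' := (component_subset hC').trans (orthSub_subset _ _)
      rcases ih' with ⟨rfl, rfl⟩ | h | h | h
      · exact .inr (.inl (component_subset hC'))
      · exact .inr (.inl (hCS'.trans h))
      · by_cases hmeet : ∃ x ∈ C, x ∈ C'
        · obtain ⟨x, hx, hx'⟩ := hmeet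
          have hsub : C ⊆ C' := subset_of_connected hC' hx' hx h
            fun _ ha _ hb => component_connected hC ha hb
          rcases ih (.step hS' hC' hβ₁') with ⟨rfl, rfl⟩ | h2 | h2 | h2
          · exact .inr (.inr (.inl (component_subset hC)))
          · have hsub' : C' ⊆ C := subset_of_connected hC hx hx' h2
              fun _ ha _ hb => component_connected hC' ha hb
            obtain rfl := hsub.antisymm hsub'
            exact .inl ⟨rfl, isHighest_unique hβ₁ hβ₁'⟩
          · exact .inr (.inr (.inl (hCS.trans h2)))
          · exact .inr (.inr (.inr fun a ha b hb => h2 a (hCS ha) b hb))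
        · have hmeet : ∀ x ∈ C, x ∉ C' := fun x hx hx' => hmeet ⟨x, hx, hx'⟩
          right; right; right
          intro a ha b hb
          have horth : ⟪b, a⟫ = 0 := by
            by_contra hne
            exact hmeet a ha (component_step hC' hb (h ha) hne)
          refine ⟨by rwa [real_inner_comm], fun hm => ?_⟩
          have hm' := ((cascadeMem_spec hS').1.orthSub β').add a (h ha) b (component_subset hC' hb)
            hm
          have hs : a + b ∈ C' := component_step hC' hb hm' (by
            rw [inner_add_right, horth, zero_add]
            exact (inner_self_pos (hcs'.subset hb)).ne')
          refine hmeet a ha (component_step hC' hs (h ha) ?_)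
          rw [inner_add_left, horth, add_zero]
          exact (inner_self_pos (hcl.subset ha)).ne'
      · exact .inr (.inr (.inr fun a ha b hb => h a ha b (hCS' hb)))

/-- Every positive root pairs positively with some cascade element. -/
lemma exists_cascadeMem_inner_pos {γ : V} (hγ : γ ∈ ctx.Pos) :
    ∃ S β, ctx.CascadeMem S β ∧ γ ∈ S ∧ 0 < ⟪γ, β⟫ := by
  have key : ∀ n, ∀ S β, ctx.CascadeMem S β → S.card = n → γ ∈ S →
      ∃ S β, ctx.CascadeMem S β ∧ γ ∈ S ∧ 0 < ⟪γ, β⟫ := by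
    intro n
    induction n using Nat.strong_induction_on with
    | _ n ih =>
      rintro S β h rfl hγS
      obtain ⟨hS, hβ⟩ := cascadeMem_spec h
      by_cases h0 : ⟪γ, β⟫ = 0
      · have hmem : γ ∈ orthSub S β := mem_orthSub.mpr ⟨hγS, h0⟩
        have hC : IsComponent (orthSub S β) (component (orthSub S β) γ) := ⟨γ, hmem, rfl⟩
        have hγC := mem_component_self hmem
        obtain ⟨β', hβ'⟩ := exists_isHighest ((hS.orthSub β).component hC) ⟨γ, hγC⟩
          fun _ hx _ hy => component_connected hC hx hy
        refine ih _ (Finset.card_lt_card ?_) _ β' (.step h hC hβ') rfl hγC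
        refine ⟨(component_subset hC).trans (orthSub_subset _ _), fun hsub => ?_⟩
        have := mem_orthSub.mp (component_subset hC (hsub hβ.1))
        exact (inner_self_pos (hS.subset hβ.1)).ne' this.2
      · exact ⟨S, β, h, hγS, lt_of_le_of_ne (hβ.inner_nonneg hS hγS hγ) (Ne.symm h0)⟩
  exact key _ _ _ .top rfl (ctx.pos_subset hγ)

lemma cascadeMem_unique {S S' : Finset V} {β β' γ : V} (h : ctx.CascadeMem S β)
    (h' : ctx.CascadeMem S' β') (hγ : γ ∈ S) (hγ' : γ ∈ S') (hp : 0 < ⟪γ, β⟫)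
    (hp' : 0 < ⟪γ, β'⟫) : S = S' ∧ β = β' := by
  rcases cascadeMem_trichotomy h h' with he | hs | hs | ho
  · exact he
  · exact absurd (mem_orthSub.mp (hs hγ')).2 hp.ne'
  · exact absurd (mem_orthSub.mp (hs hγ)).2 hp'.ne'
  · exact absurd (ho γ hγ γ hγ').1 (inner_self_pos ((cascadeMem_spec h).1.subset hγ)).ne'

variable {K : Finset V}

lemma IsCascade.pos (hK : ctx.IsCascade K) {β : V} (hβ : β ∈ K) : β ∈ ctx.Pos := by
  obtain ⟨S, h⟩ := (hK β).mp hβ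
  exact (cascadeMem_spec h).2.2.1

lemma IsCascade.mem (hK : ctx.IsCascade K) {β : V} (hβ : β ∈ K) : β ∈ ctx.Δ :=
  ctx.pos_subset (hK.pos hβ)

lemma IsCascade.strongly_orthogonal (hK : ctx.IsCascade K) {β β' : V} (hβ : β ∈ K) (hβ' : β' ∈ K)
    (hne : β ≠ β') : ⟪β, β'⟫ = 0 ∧ β + β' ∉ ctx.Δ := by
  obtain ⟨S, h⟩ := (hK β).mp hβ
  obtain ⟨S', h'⟩ := (hK β').mp hβ'
  obtain ⟨hS, hb⟩ := cascadeMem_spec h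
  obtain ⟨hS', hb'⟩ := cascadeMem_spec h'
  rcases cascadeMem_trichotomy h h' with he | hs | hs | ho
  · exact absurd he.2 hne
  · obtain ⟨h1, h2⟩ := mem_orthSub.mp (hs hb'.1)
    exact ⟨by rwa [real_inner_comm], hb.add_notMem hS h1 h2⟩
  · obtain ⟨h1, h2⟩ := mem_orthSub.mp (hs hb.1)
    exact ⟨h2, by rw [add_comm]; exact hb'.add_notMem hS' h1 h2⟩
  · exact ho β hb.1 β' hb'.1

/-- The opposite of the product of the reflections in the cascade elements. -/
noncomputable def cascInv (K : Finset V) (v : V) : V := ∑ β ∈ K, cartanPairing v β • β - v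

lemma cascInv_add (K : Finset V) (v w : V) : cascInv K (v + w) = cascInv K v + cascInv K w := by
  have : ∀ β, cartanPairing (v + w) β • β = cartanPairing v β • β + cartanPairing w β • β := by
    intro β
    rw [← add_smul]
    congr 1
    rw [cartanPairing, cartanPairing, cartanPairing, inner_add_left]
    ring
  simp only [cascInv, this, Finset.sum_add_distrib]
  abel

lemma cascInv_zero (K : Finset V) : cascInv K 0 = 0 := by
  simp [cascInv, cartanPairing]

lemma IsCascade.inner_sum_smul (hK : ctx.IsCascade K) (c : V → ℝ) {β : V} (hβ : β ∈ K) :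
    ⟪∑ β' ∈ K, c β' • β', β⟫ = c β * ⟪β, β⟫ := by
  rw [sum_inner, Finset.sum_eq_single_of_mem β hβ]
  · rw [real_inner_smul_left]
  · intro b hb hne
    rw [real_inner_smul_left, (hK.strongly_orthogonal hb hβ hne).1, mul_zero]

lemma IsCascade.inner_cascInv (hK : ctx.IsCascade K) (v : V) {β : V} (hβ : β ∈ K) :
    ⟪cascInv K v, β⟫ = ⟪v, β⟫ := by
  rw [cascInv, inner_sub_left, hK.inner_sum_smul _ hβ, cartanPairing_mul_inner (hK.mem hβ)]
  ring

lemma IsCascade.cartanPairing_cascInv (hK : ctx.IsCascade K) (v : V) {β : V} (hβ : β ∈ K) :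
    cartanPairing (cascInv K v) β = cartanPairing v β := by
  rw [cartanPairing, hK.inner_cascInv v hβ, cartanPairing]

lemma IsCascade.cascInv_cascInv (hK : ctx.IsCascade K) (v : V) :
    cascInv K (cascInv K v) = v := by
  rw [cascInv, Finset.sum_congr rfl fun β hβ => by rw [hK.cartanPairing_cascInv v hβ], cascInv]
  abel

lemma inner_cascInv_left (K : Finset V) (v w : V) :
    ⟪cascInv K v, w⟫ = ⟪v, cascInv K w⟫ := by
  simp only [cascInv, inner_sub_left, inner_sub_right, sum_inner, inner_sum, real_inner_smul_left,
    real_inner_smul_right]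
  congr 1
  refine Finset.sum_congr rfl fun β hβ => ?_
  rw [cartanPairing, cartanPairing, real_inner_comm w β]
  ring

lemma IsCascade.inner_cascInv_cascInv (hK : ctx.IsCascade K) (v w : V) :
    ⟪cascInv K v, cascInv K w⟫ = ⟪v, w⟫ := by
  rw [inner_cascInv_left, hK.cascInv_cascInv]

lemma IsCascade.neg_cascInv_mem (hK : ctx.IsCascade K) {S : Finset V}
    (hS : ctx.IsClosedSubsystem S) {γ : V} (hγ : γ ∈ S) (h : ∀ β ∈ K, β ∈ S ∨ ⟪γ, β⟫ = 0) :
    -cascInv K γ ∈ S := by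
  suffices ∀ F ⊆ K, γ - ∑ β ∈ F, cartanPairing γ β • β ∈ S by
    have := this K subset_rfl
    rwa [cascInv, neg_sub]
  intro F
  induction F using Finset.induction_on with
  | empty => simpa using hγ
  | insert β F hβ ih =>
    intro hF
    rw [Finset.insert_subset_iff] at hF
    have h0 := ih hF.2
    rw [Finset.sum_insert hβ]
    rcases h β hF.1 with hm | hm
    · have := hS.reflect β hm _ h0
      have e : cartanPairing (γ - ∑ β ∈ F, cartanPairing γ β • β) β = cartanPairing γ β := by
        rw [cartanPairing, inner_sub_left, sum_inner, Finset.sum_eq_zero, sub_zero, cartanPairing]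
        intro b hb
        rw [real_inner_smul_left,
          (hK.strongly_orthogonal (hF.2 hb) hF.1 (by rintro rfl; exact hβ hb)).1, mul_zero]
      rw [e] at this
      convert this using 1
      abel
    · simpa [cartanPairing, hm] using h0

lemma IsCascade.cascInv_pos (hK : ctx.IsCascade K) {γ : V} (hγ : γ ∈ ctx.Pos) :
    cascInv K γ ∈ ctx.Pos := by
  obtain ⟨S, β, h, hγS, hp⟩ := exists_cascadeMem_inner_pos hγ
  obtain ⟨hS, hβ⟩ := cascadeMem_spec h
  have hm : -cascInv K γ ∈ S := by
    refine hK.neg_cascInv_mem hS hγS fun β' hβ' => ?_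
    obtain ⟨S', h'⟩ := (hK β').mp hβ'
    have hb' := (cascadeMem_spec h').2.1
    rcases cascadeMem_trichotomy h h' with he | hs | hs | ho
    · exact .inl (he.2 ▸ hβ.1)
    · exact .inl (mem_orthSub.mp (hs hb')).1
    · exact .inr (mem_orthSub.mp (hs hγS)).2
    · exact .inr (ho γ hγS β' hb').1
  rcases ctx.pos_or_neg _ (hS.subset hm) with hn | hn
  · have := hβ.inner_nonneg hS hm hn
    rw [inner_neg_left, hK.inner_cascInv γ ((hK β).mpr ⟨S, h⟩)] at this
    linarith
  · rwa [neg_neg] at hn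

lemma IsCascade.cascInv_base (hK : ctx.IsCascade K) {α : V} (hα : α ∈ ctx.base) :
    cascInv K α ∈ ctx.base := by
  have hmono : ∀ x ∈ AddSubmonoid.closure (ctx.base : Set V),
      ctx.height x ≤ ctx.height (cascInv K x) := by
    intro x hx
    induction hx using AddSubmonoid.closure_induction with
    | mem x hx =>
      exact (height_base hx).le.trans (one_le_height (hK.cascInv_pos (ctx.base_subset hx)))
    | zero => rw [cascInv_zero]
    | add x y _ _ hx hy =>
      rw [cascInv_add, map_add, map_add]
      exact add_le_add hx hy
  have hp := hK.cascInv_pos (ctx.base_subset hα)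
  have := hmono _ (ctx.pos_coords _ hp)
  rw [hK.cascInv_cascInv, height_base hα] at this
  exact mem_base_of_height hp this

end Cascade

section Integrality

variable {ctx}

lemma smul_mem_iff {γ : V} {ε : ℤ} (hε : ε = 1 ∨ ε = -1) : (ε : ℝ) • γ ∈ ctx.Δ ↔ γ ∈ ctx.Δ := by
  rcases hε with rfl | rfl
  · simp
  · simp only [Int.cast_neg, Int.cast_one, neg_smul, one_smul]
    exact ⟨fun h => by simpa using ctx.neg_mem _ h, ctx.neg_mem γ⟩

variable {K : Finset V}

lemma IsCascade.smul_add_smul_notMem (hK : ctx.IsCascade K) {a b : V} (ha : a ∈ K) (hb : b ∈ K)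
    (hne : a ≠ b) {ε ε' : ℤ} (hε : ε = 1 ∨ ε = -1) (hε' : ε' = 1 ∨ ε' = -1) :
    (ε : ℝ) • a + (ε' : ℝ) • b ∉ ctx.Δ := by
  obtain ⟨horth, hadd⟩ := hK.strongly_orthogonal ha hb hne
  have hsub : a - b ∉ ctx.Δ := fun h => hadd (add_mem_of_sub_mem (hK.mem hb) horth h)
  intro h
  rcases hε with rfl | rfl <;> rcases hε' with rfl | rfl <;>
    simp only [Int.cast_neg, Int.cast_one, neg_smul, one_smul] at h
  · exact hadd h
  · exact hsub (by rwa [sub_eq_add_neg])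
  · exact hsub (by simpa [sub_eq_add_neg, add_comm] using ctx.neg_mem _ h)
  · exact hadd (by simpa [add_comm] using ctx.neg_mem _ h)

/-- The possible values of a pair of Cartan integers in a reduced root system, up to parity. -/
lemma cartanPairing_parity (hred : ∀ γ ∈ ctx.Δ, (2 : ℝ) • γ ∉ ctx.Δ) {a b : V} (ha : a ∈ ctx.Δ)
    (hb : b ∈ ctx.Δ) {m n : ℤ} (hm : cartanPairing a b = m) (hn : cartanPairing b a = n) :
    0 ≤ m * n ∧ (m * n = 0 → m = 0) ∧ (m * n = 1 → m = 1 ∨ m = -1) ∧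
    (m * n = 2 → (m = 1 ∨ m = -1) ∨ (m = 2 ∨ m = -2)) ∧
    Even (m - m * n - if m * n = 2 ∧ (m = 1 ∨ m = -1) then 1 else 0) := by
  have haa := inner_self_pos ha
  have hbb := inner_self_pos hb
  have em := cartanPairing_mul_inner hb a
  have en := cartanPairing_mul_inner ha b
  rw [real_inner_comm a b] at en
  rw [hm] at em
  rw [hn] at en
  have hcs := real_inner_mul_inner_self_le a b
  have e : (m * n : ℝ) * (⟪a, a⟫ * ⟪b, b⟫) = 4 * (⟪a, b⟫ * ⟪a, b⟫) := by
    linear_combination (n * ⟪a, a⟫) * em + 2 * ⟪a, b⟫ * en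
  have hab := mul_pos haa hbb
  have h0 : 0 ≤ m * n := by
    have : (0 : ℝ) ≤ m * n := by
      by_contra! h
      nlinarith [mul_self_nonneg ⟪a, b⟫]
    exact_mod_cast this
  have h4 : m * n ≤ 4 := by
    have : (m * n : ℝ) ≤ 4 := by
      by_contra! h
      nlinarith
    exact_mod_cast this
  have hm0 : m * n = 0 → m = 0 := by
    intro h
    rcases mul_eq_zero.mp h with h | h
    · exact h
    · rw [h] at en
      have : (m : ℝ) * ⟪b, b⟫ = 0 := by rw [em, ← en]; simp
      exact_mod_cast (mul_eq_zero.mp this).resolve_right hbb.ne'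
  have hne : ¬ (n = 4 * m ∧ m * m = 1) := by
    rintro ⟨h, hm1⟩
    have hm1' : (m * m : ℝ) = 1 := by exact_mod_cast hm1
    have : (2 : ℝ) • a = (m : ℝ) • b := by
      rw [← sub_eq_zero, ← inner_self_eq_zero (𝕜 := ℝ)]
      simp only [inner_sub_left, inner_sub_right, real_inner_smul_left, real_inner_smul_right]
      rw [real_inner_comm a b]
      have h' : (n : ℝ) = 4 * m := by exact_mod_cast h
      rw [h'] at en
      linear_combination (m : ℝ) * en + m * em - 4 * ⟪a, a⟫ * hm1'
    have hmem := (smul_mem_iff (ε := m) (by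
      rcases Int.isUnit_iff.mp (IsUnit.of_mul_eq_one m hm1) with h | h <;> simp [h])).mpr hb
    rw [← this] at hmem
    exact hred a ha hmem
  have hmb : m ≤ 4 ∧ -4 ≤ m := by
    by_cases h : m = 0
    · simp [h]
    · have hn0 : n ≠ 0 := fun h' => h (hm0 (by simp [h']))
      rcases lt_or_gt_of_ne h with h | h <;> rcases lt_or_gt_of_ne hn0 with h' | h' <;>
        constructor <;> nlinarith
  have hnb : m = 0 ∨ (n ≤ 4 ∧ -4 ≤ n) := by
    by_cases h : m = 0
    · exact .inl h
    · right
      rcases lt_or_gt_of_ne h with h | h <;> constructor <;> nlinarith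
  clear em en hm hn e
  refine ⟨h0, hm0, ?_⟩
  obtain ⟨hm1, hm2⟩ := hmb
  rcases hnb with rfl | ⟨hn1, hn2⟩
  · simp
  · interval_cases m <;> interval_cases n <;> first
      | (exfalso; omega)
      | norm_num [Int.even_iff]

lemma exists_pos_of_sum_pos {ι : Type*} {s : Finset ι} {f : ι → ℤ} (h : 0 < ∑ i ∈ s, f i) :
    ∃ i ∈ s, 0 < f i := by
  by_contra! hc
  exact absurd (Finset.sum_nonpos hc) h.not_ge

lemma sum_eq_of_nonneg_of_le {s : Finset V} {f : V → ℤ} (c : V → ℝ)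
    (h0 : ∀ i ∈ s, 0 ≤ f i) (hc : ∀ i ∈ s, f i = 0 → c i = 0) {a : V} (ha : a ∈ s)
    (h : ∑ i ∈ s, f i ≤ f a) : ∑ i ∈ s, c i • i = c a • a := by
  rw [← Finset.add_sum_erase s f ha] at h
  have h0' : ∀ i ∈ s.erase a, 0 ≤ f i := fun i hi => h0 i (Finset.mem_of_mem_erase hi)
  have hz : ∑ i ∈ s.erase a, f i = 0 :=
    le_antisymm (by linarith) (Finset.sum_nonneg h0')
  refine Finset.sum_eq_single_of_mem a ha fun b hb hne => ?_
  have hb' := Finset.mem_erase.mpr ⟨hne, hb⟩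
  rw [hc b hb ((Finset.sum_eq_zero_iff_of_nonneg h0').mp hz b hb'), zero_smul]

/-- A simple root that is fixed by, or orthogonal to its image under, the cascade involution has
integral pairing with the cascade element. -/
lemma IsCascade.even_sum_cartanPairing (hK : ctx.IsCascade K)
    (hred : ∀ γ ∈ ctx.Δ, (2 : ℝ) • γ ∉ ctx.Δ) {α : V} (hα : α ∈ ctx.base)
    (h : cascInv K α = α ∨ ⟪cascInv K α, α⟫ = 0) :
    ∃ k : ℤ, ∑ β ∈ K, cartanPairing α β = 2 * k := by
  have hαΔ := ctx.pos_subset (ctx.base_subset hα)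
  have hαα := inner_self_pos hαΔ
  choose! m hm using fun β (hβ : β ∈ K) => ctx.pairing_int β (hK.mem hβ) α hαΔ
  choose! n hn using fun β (hβ : β ∈ K) => ctx.pairing_int α hαΔ β (hK.mem hβ)
  have hpar := fun β (hβ : β ∈ K) => cartanPairing_parity hred hαΔ (hK.mem hβ) (hm β hβ) (hn β hβ)
  have hsum : α + cascInv K α = ∑ β ∈ K, (m β : ℝ) • β := by
    rw [cascInv, add_sub_cancel]
    exact Finset.sum_congr rfl fun β hβ => by rw [hm β hβ]
  have hs : (∑ β ∈ K, m β * n β = 4 ∧ cascInv K α = α) ∨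
      (∑ β ∈ K, m β * n β = 2 ∧ ⟪cascInv K α, α⟫ = 0) := by
    have e : ((∑ β ∈ K, m β * n β : ℤ) : ℝ) * ⟪α, α⟫ = 2 * ⟪α + cascInv K α, α⟫ := by
      rw [hsum, sum_inner, Int.cast_sum, Finset.sum_mul, Finset.mul_sum]
      refine Finset.sum_congr rfl fun β hβ => ?_
      have := cartanPairing_mul_inner hαΔ β
      rw [hn β hβ] at this
      rw [real_inner_smul_left]
      push_cast
      linear_combination (m β : ℝ) * this
    rw [inner_add_left] at e
    rcases h with h | h
    · left
      rw [h] at e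
      refine ⟨?_, h⟩
      have : ((∑ β ∈ K, m β * n β : ℤ) : ℝ) = 4 := by
        apply mul_right_cancel₀ hαα.ne'
        linarith
      exact_mod_cast this
    · right
      rw [h] at e
      refine ⟨?_, h⟩
      have : ((∑ β ∈ K, m β * n β : ℤ) : ℝ) = 2 := by
        apply mul_right_cancel₀ hαα.ne'
        linarith
      exact_mod_cast this
  suffices Even (∑ β ∈ K, m β) by
    obtain ⟨k, hk⟩ := this
    refine ⟨k, ?_⟩
    rw [Finset.sum_congr rfl hm, ← Int.cast_sum, hk]
    push_cast
    ring
  by_contra hodd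
  let bad : V → Prop := fun β => m β * n β = 2 ∧ (m β = 1 ∨ m β = -1)
  have hev : Even (∑ β ∈ K, (m β - m β * n β - if bad β then 1 else 0)) :=
    Finset.even_sum _ fun β hβ => by convert (hpar β hβ).2.2.2.2
  rw [Finset.sum_sub_distrib, Finset.sum_sub_distrib, Finset.sum_boole] at hev
  have hcard : (K.filter bad).card = 1 := by
    have h1 : (2 : ℤ) * (K.filter bad).card ≤ ∑ β ∈ K, m β * n β := by
      calc (2 : ℤ) * (K.filter bad).card = ∑ β ∈ K.filter bad, m β * n β := by
            rw [Finset.sum_congr rfl fun β hβ => (Finset.mem_filter.mp hβ).2.1]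
            simp [mul_comm]
        _ ≤ _ := Finset.sum_le_sum_of_subset_of_nonneg (Finset.filter_subset _ _)
            fun β hβ _ => (hpar β hβ).1
    rw [Int.not_even_iff_odd] at hodd
    obtain ⟨i, hi⟩ := hodd
    obtain ⟨j, hj⟩ := hev
    replace hj : ∑ β ∈ K, m β - ∑ β ∈ K, m β * n β - ((K.filter bad).card : ℤ) = j + j := by
      convert hj
    generalize (K.filter bad).card = c at hj h1 ⊢
    omega
  obtain ⟨β₁, hβ₁⟩ := Finset.card_eq_one.mp hcard
  obtain ⟨hβ₁K, hbad₁⟩ := Finset.mem_filter.mp (hβ₁ ▸ Finset.mem_singleton_self β₁)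
  have hgood : ∀ β ∈ K.erase β₁, ¬ bad β := by
    intro β hβ hb
    have : β ∈ K.filter bad := Finset.mem_filter.mpr ⟨Finset.mem_of_mem_erase hβ, hb⟩
    rw [hβ₁, Finset.mem_singleton] at this
    exact Finset.ne_of_mem_erase hβ this
  have hR : ∀ β ∈ K.erase β₁, 0 ≤ m β * n β := fun β hβ => (hpar β (Finset.mem_of_mem_erase hβ)).1
  have hm₁β₁ : (m β₁ : ℝ) • β₁ ∈ ctx.Δ := (smul_mem_iff hbad₁.2).mpr (hK.mem hβ₁K)
  have hz : ∀ β ∈ K, m β * n β = 0 → (m β : ℝ) = 0 := fun β hβ h0 => by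
    exact_mod_cast (hpar β hβ).2.1 h0
  rcases hs with ⟨hs, hfix⟩ | ⟨hs, horth⟩
  · have hα' : α - (m β₁ : ℝ) • β₁ ∈ ctx.Δ := by
      have := ctx.reflect_mem β₁ (hK.mem hβ₁K) α hαΔ
      rwa [hm β₁ hβ₁K] at this
    have hδ : ∑ β ∈ K.erase β₁, (m β : ℝ) • β ∈ ctx.Δ := by
      have h1 : ⟪α, α - (m β₁ : ℝ) • β₁⟫ = 0 := by
        have e := cartanPairing_mul_inner hαΔ β₁
        rw [hn β₁ hβ₁K, real_inner_comm α β₁] at e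
        have e2 : (m β₁ : ℝ) * n β₁ = 2 := by exact_mod_cast hbad₁.1
        rw [inner_sub_right, real_inner_smul_right]
        linear_combination (m β₁ : ℝ) / 2 * e - ⟪α, α⟫ / 2 * e2
      have h2 := add_mem_of_sub_mem hα' h1 (by rwa [sub_sub_cancel])
      rw [hfix, ← Finset.add_sum_erase K _ hβ₁K] at hsum
      convert h2 using 1
      rw [← add_sub_assoc, hsum, add_sub_cancel_left]
    rw [← Finset.add_sum_erase K _ hβ₁K, hbad₁.1] at hs
    obtain ⟨β₂, hβ₂, hp₂⟩ := exists_pos_of_sum_pos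
      (show 0 < ∑ β ∈ K.erase β₁, m β * n β by omega)
    have hβ₂K := Finset.mem_of_mem_erase hβ₂
    obtain ⟨-, -, hone, htwo, -⟩ := hpar β₂ hβ₂K
    by_cases h2 : m β₂ * n β₂ = 2
    · rw [sum_eq_of_nonneg_of_le (fun β => (m β : ℝ)) hR
        (fun β hβ => hz β (Finset.mem_of_mem_erase hβ)) hβ₂ (by omega)] at hδ
      have hm2 := (htwo h2).resolve_left fun h' => hgood β₂ hβ₂ ⟨h2, h'⟩
      apply hred β₂ (hK.mem hβ₂K)
      rcases hm2 with h' | h'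
      · simpa [h'] using hδ
      · simpa [h'] using ctx.neg_mem _ hδ
    · have hR' : ∀ β ∈ (K.erase β₁).erase β₂, 0 ≤ m β * n β :=
        fun β hβ => hR β (Finset.mem_of_mem_erase hβ)
      rw [← Finset.add_sum_erase _ _ hβ₂] at hs
      have hnn := Finset.sum_nonneg hR'
      have h1 : m β₂ * n β₂ = 1 := by omega
      obtain ⟨β₃, hβ₃, hp₃⟩ := exists_pos_of_sum_pos
        (show 0 < ∑ β ∈ (K.erase β₁).erase β₂, m β * n β by omega)
      have hle : m β₃ * n β₃ ≤ _ := Finset.single_le_sum hR' hβ₃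
      have hβ₃K := Finset.mem_of_mem_erase (Finset.mem_of_mem_erase hβ₃)
      rw [← Finset.add_sum_erase _ _ hβ₂,
        sum_eq_of_nonneg_of_le (fun β => (m β : ℝ)) hR' (fun β hβ =>
          hz β (Finset.mem_of_mem_erase (Finset.mem_of_mem_erase hβ))) hβ₃ (by omega)] at hδ
      exact hK.smul_add_smul_notMem hβ₂K hβ₃K (Finset.ne_of_mem_erase hβ₃).symm
        (hone h1) ((hpar β₃ hβ₃K).2.2.1 (by omega)) hδ
  · have hle : ∑ β ∈ K, m β * n β ≤ m β₁ * n β₁ := by rw [hs, hbad₁.1]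
    rw [sum_eq_of_nonneg_of_le (fun β => (m β : ℝ)) (fun β hβ => (hpar β hβ).1) hz hβ₁K hle]
      at hsum
    rw [← hsum] at hm₁β₁
    exact base_sub_notMem hα (hK.cascInv_base hα) (sub_mem_of_add_mem
      (ctx.pos_subset (ctx.base_subset (hK.cascInv_base hα))) (by rwa [real_inner_comm]) hm₁β₁)

lemma inner_cascElt (K : Finset V) (γ : V) :
    ⟪γ, cascElt K⟫ = (∑ β ∈ K, cartanPairing γ β) / 2 := by
  rw [cascElt, _root_.inner_sum, Finset.sum_div]
  refine Finset.sum_congr rfl fun β _ => ?_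
  rw [real_inner_smul_right, cartanPairing]
  ring

end Integrality

section Counting

variable {ctx} {K : Finset V}

lemma IsCascade.inner_cascElt_self (hK : ctx.IsCascade K) {β : V} (hβ : β ∈ K) :
    ⟪β, cascElt K⟫ = 1 := by
  rw [real_inner_comm, cascElt, hK.inner_sum_smul _ hβ,
    inv_mul_cancel₀ (inner_self_pos (hK.mem hβ)).ne']

/-- Number of odd roots and of even roots for the grading defined by the cascade element. -/
lemma IsCascade.card_parity (hK : ctx.IsCascade K)
    (hint : ∀ α ∈ ctx.base, ∃ k : ℤ, ⟪α, cascElt K⟫ = k) :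
    (ctx.Δ.filter fun γ => ∃ k : ℤ, Even k ∧ ⟪γ, cascElt K⟫ = (k : ℝ)).card + K.card =
        ctx.Pos.card ∧
    (ctx.Δ.filter fun γ => ∃ k : ℤ, Odd k ∧ ⟪γ, cascElt K⟫ = (k : ℝ)).card =
        ctx.Pos.card + K.card := by
  have hint' : ∀ γ ∈ ctx.Pos, ∃ k : ℤ, ⟪γ, cascElt K⟫ = k := by
    intro γ hγ
    have := ctx.pos_coords γ hγ
    clear hγ
    induction this using AddSubmonoid.closure_induction with
    | mem x hx => exact hint x hx
    | zero => exact ⟨0, by simp⟩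
    | add x y _ _ hx hy =>
      obtain ⟨k, hk⟩ := hx
      obtain ⟨l, hl⟩ := hy
      exact ⟨k + l, by rw [inner_add_left, hk, hl, Int.cast_add]⟩
  set E : V → Prop := fun γ => ∃ k : ℤ, Even k ∧ ⟪γ, cascElt K⟫ = (k : ℝ) with hE
  set O : V → Prop := fun γ => ∃ k : ℤ, Odd k ∧ ⟪γ, cascElt K⟫ = (k : ℝ) with hO
  have hOE : ∀ γ ∈ ctx.Pos, (O γ ↔ ¬ E γ) := by
    intro γ hγ
    constructor
    · rintro ⟨k, hk, e⟩ ⟨l, hl, e'⟩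
      rw [e] at e'
      obtain rfl : k = l := by exact_mod_cast e'
      exact Int.not_even_iff_odd.mpr hk hl
    · intro h
      obtain ⟨k, hk⟩ := hint' γ hγ
      rcases Int.even_or_odd k with h' | h'
      · exact absurd ⟨k, h', hk⟩ h
      · exact ⟨k, h', hk⟩
  have hdouble : ∀ P : V → Prop, (∀ γ, P γ ↔ P (-γ)) →
      (ctx.Δ.filter P).card = 2 * (ctx.Pos.filter P).card := by
    intro P hP
    have : ctx.Δ.filter P = ctx.Pos.filter P ∪ (ctx.Pos.filter P).image Neg.neg := by
      ext γ
      simp only [Finset.mem_filter, Finset.mem_union, Finset.mem_image]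
      constructor
      · rintro ⟨h, hp⟩
        rcases ctx.pos_or_neg γ h with h | h
        · exact .inl ⟨h, hp⟩
        · exact .inr ⟨-γ, ⟨h, (hP γ).mp hp⟩, neg_neg γ⟩
      · rintro (⟨h, hp⟩ | ⟨δ, ⟨h, hp⟩, rfl⟩)
        · exact ⟨ctx.pos_subset h, hp⟩
        · exact ⟨ctx.neg_mem _ (ctx.pos_subset h), (hP δ).mp hp⟩
    rw [this, Finset.card_union_of_disjoint, Finset.card_image_of_injective _ neg_injective]
    · ring
    · rw [Finset.disjoint_left]
      intro γ h h'
      simp only [Finset.mem_filter, Finset.mem_image] at h h'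
      obtain ⟨δ, ⟨h', -⟩, rfl⟩ := h'
      exact ctx.pos_not_neg δ h' h.1
  have hEneg : ∀ γ, E γ ↔ E (-γ) := by
    have : ∀ γ, E γ → E (-γ) := by
      rintro γ ⟨k, hk, e⟩
      exact ⟨-k, hk.neg, by rw [inner_neg_left, e, Int.cast_neg]⟩
    exact fun γ => ⟨this γ, fun h => by simpa using this _ h⟩
  have hOneg : ∀ γ, O γ ↔ O (-γ) := by
    have : ∀ γ, O γ → O (-γ) := by
      rintro γ ⟨k, hk, e⟩
      exact ⟨-k, hk.neg, by rw [inner_neg_left, e, Int.cast_neg]⟩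
    exact fun γ => ⟨this γ, fun h => by simpa using this _ h⟩
  choose! S b hSb using fun γ (hγ : γ ∈ ctx.Pos) => exists_cascadeMem_inner_pos hγ
  have hflip : ∀ γ ∈ ctx.Pos, γ ∉ K → b γ - γ ∈ ctx.Pos ∧ b γ - γ ∉ K ∧ b (b γ - γ) = b γ ∧
      ⟪b γ - γ, cascElt K⟫ = 1 - ⟪γ, cascElt K⟫ := by
    intro γ hγ hγK
    obtain ⟨h, hγS, hp⟩ := hSb γ hγ
    obtain ⟨hS, hb⟩ := cascadeMem_spec h
    have hbK : b γ ∈ K := (hK _).mpr ⟨_, h⟩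
    have hm := sub_mem (hS.subset hb.1) (hS.subset hγS) (by rintro e; exact hγK (e ▸ hbK))
      (by rwa [real_inner_comm])
    have hmS := hS.sub hb.1 hγS hm
    have hpos : b γ - γ ∈ ctx.Pos := by
      rcases ctx.pos_or_neg _ hm with h' | h'
      · exact h'
      · exact absurd (hb.2.2 γ hγS) (not_rootLE_of_pos (by rwa [neg_sub] at h'))
    have hin : 0 < ⟪b γ - γ, b γ⟫ := by
      refine lt_of_le_of_ne (hb.inner_nonneg hS hmS hpos) fun h0 => ?_
      refine hb.add_notMem hS hmS h0.symm (add_mem_of_sub_mem hm ?_ ?_)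
      · rw [real_inner_comm, ← h0]
      · rw [sub_sub_cancel]
        exact hS.subset hγS
    have hbb : b (b γ - γ) = b γ := by
      obtain ⟨h1, h2, h3⟩ := hSb _ hpos
      exact (cascadeMem_unique h1 h h2 hmS h3 hin).2
    refine ⟨hpos, fun hmK => ?_, hbb, ?_⟩
    · have := (hK.strongly_orthogonal hmK hbK (by
        intro e
        rw [sub_eq_self] at e
        exact ctx.zero_not_mem (e ▸ hS.subset hγS))).1
      exact hin.ne' this
    · rw [inner_sub_left, hK.inner_cascElt_self hbK]
  have hcard : ((ctx.Pos \ K).filter O).card = ((ctx.Pos \ K).filter E).card := by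
    refine Finset.card_bij' (fun γ _ => b γ - γ) (fun γ _ => b γ - γ) ?_ ?_ ?_ ?_
    · intro γ hγ
      simp only [Finset.mem_filter, Finset.mem_sdiff] at hγ ⊢
      obtain ⟨h1, h2, -, h4⟩ := hflip γ hγ.1.1 hγ.1.2
      obtain ⟨k, hk, e⟩ := hγ.2
      exact ⟨⟨h1, h2⟩, 1 - k, odd_one.sub_odd hk, by rw [h4, e]; simp⟩
    · intro γ hγ
      simp only [Finset.mem_filter, Finset.mem_sdiff] at hγ ⊢
      obtain ⟨h1, h2, -, h4⟩ := hflip γ hγ.1.1 hγ.1.2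
      obtain ⟨k, hk, e⟩ := hγ.2
      exact ⟨⟨h1, h2⟩, 1 - k, odd_one.sub_even hk, by rw [h4, e]; simp⟩
    · intro γ hγ
      simp only [Finset.mem_filter, Finset.mem_sdiff] at hγ
      rw [(hflip γ hγ.1.1 hγ.1.2).2.2.1, sub_sub_cancel]
    · intro γ hγ
      simp only [Finset.mem_filter, Finset.mem_sdiff] at hγ
      rw [(hflip γ hγ.1.1 hγ.1.2).2.2.1, sub_sub_cancel]
  have hKO : ∀ γ ∈ K, O γ := fun γ hγ => ⟨1, odd_one, by rw [hK.inner_cascElt_self hγ]; simp⟩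
  have hEsd : (ctx.Pos \ K).filter E = ctx.Pos.filter E := by
    ext γ
    simp only [Finset.mem_filter, Finset.mem_sdiff]
    exact ⟨fun h => ⟨h.1.1, h.2⟩, fun h => ⟨⟨h.1, fun hγ => (hOE γ h.1).mp (hKO γ hγ) h.2⟩, h.2⟩⟩
  have hOsd : (ctx.Pos.filter O).card = ((ctx.Pos \ K).filter O).card + K.card := by
    rw [← Finset.card_union_of_disjoint]
    · congr 1
      ext γ
      simp only [Finset.mem_filter, Finset.mem_sdiff, Finset.mem_union]
      constructor
      · rintro ⟨h1, h2⟩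
        by_cases h : γ ∈ K
        · exact .inr h
        · exact .inl ⟨⟨h1, h⟩, h2⟩
      · rintro (⟨⟨h1, -⟩, h2⟩ | h)
        · exact ⟨h1, h2⟩
        · exact ⟨hK.pos h, hKO γ h⟩
    · rw [Finset.disjoint_left]
      intro γ h
      simp only [Finset.mem_filter, Finset.mem_sdiff] at h
      exact h.1.2
  have htot : (ctx.Pos.filter E).card + (ctx.Pos.filter O).card = ctx.Pos.card := by
    rw [Finset.filter_congr hOE]
    exact Finset.card_filter_add_card_filter_not _
  rw [hdouble E hEneg, hdouble O hOneg]
  rw [hEsd] at hcard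
  omega

end Counting

section TypeA

variable {ctx}

lemma base_mem {a : V} (ha : a ∈ ctx.base) : a ∈ ctx.Δ := ctx.pos_subset (ctx.base_subset ha)

lemma inner_eq_zero_of_mem_closure {X : Set V} {v w : V} (h : ∀ a ∈ X, ⟪a, w⟫ = 0)
    (hv : v ∈ AddSubmonoid.closure X) : ⟪v, w⟫ = 0 := by
  induction hv using AddSubmonoid.closure_induction with
  | mem x hx => exact h x hx
  | zero => exact inner_zero_left _
  | add x y _ _ hx hy => rw [inner_add_left, hx, hy, add_zero]

lemma exists_base_inner_pos {γ : V} (hγ : γ ∈ ctx.Pos) : ∃ b ∈ ctx.base, 0 < ⟪γ, b⟫ := by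
  by_contra! h
  have key : ∀ v ∈ AddSubmonoid.closure (ctx.base : Set V), ⟪γ, v⟫ ≤ 0 := by
    intro v hv
    induction hv using AddSubmonoid.closure_induction with
    | mem x hx => exact h x hx
    | zero => simp
    | add x y _ _ hx hy =>
      rw [inner_add_right]
      linarith
  exact (key γ (ctx.pos_coords γ hγ)).not_gt (inner_self_pos (ctx.pos_subset hγ))

/-- If the base splits into two orthogonal parts, then every positive root is supported on one
of them. -/
lemma mem_closure_or_mem_closure {X Y : Set V} (hXY : ∀ a ∈ X, ∀ b ∈ Y, ⟪a, b⟫ = 0)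
    (hb : ∀ b ∈ ctx.base, b ∈ X ∨ b ∈ Y) {γ : V} (hγ : γ ∈ ctx.Pos) :
    γ ∈ AddSubmonoid.closure X ∨ γ ∈ AddSubmonoid.closure Y := by
  have key : ∀ n : ℕ, ∀ γ ∈ ctx.Pos, ctx.height γ ≤ n →
      γ ∈ AddSubmonoid.closure X ∨ γ ∈ AddSubmonoid.closure Y := by
    intro n
    induction n with
    | zero =>
      intro γ hγ h
      have := one_le_height hγ
      norm_num at h
      linarith
    | succ n ih =>
      intro γ hγ hn
      push_cast at hn
      by_cases hγb : γ ∈ ctx.base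
      · exact (hb γ hγb).imp (fun h => AddSubmonoid.subset_closure h)
          fun h => AddSubmonoid.subset_closure h
      obtain ⟨b, hbb, hp⟩ := exists_base_inner_pos hγ
      have h2 : 2 ≤ ctx.height γ := by
        rcases closure_cases (ctx.pos_coords γ hγ) with rfl | h | h
        · exact absurd (ctx.pos_subset hγ) ctx.zero_not_mem
        · exact absurd h hγb
        · exact h
      have hsub : ∀ c : ℝ, c ≤ 2 → γ - c • b ∈ ctx.Δ → γ - c • b ∈ ctx.Pos := by
        intro c hc h
        refine (ctx.pos_or_neg _ h).resolve_right fun h' => ?_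
        have := one_le_height h'
        rw [map_neg, map_sub, map_smul, height_base hbb, smul_eq_mul] at this
        linarith
      have hδ : γ - b ∈ ctx.Δ := sub_mem (ctx.pos_subset hγ) (base_mem hbb)
        (fun h => hγb (h ▸ hbb)) hp
      have hδp : γ - b ∈ ctx.Pos := by
        simpa using hsub 1 (by norm_num) (by simpa using hδ)
      have hδh : ctx.height (γ - b) ≤ n := by
        rw [map_sub, height_base hbb]
        linarith
      have step : ∀ X Y : Set V, (∀ a ∈ X, ∀ b ∈ Y, ⟪a, b⟫ = 0) →
          (∀ γ ∈ ctx.Pos, ctx.height γ ≤ n →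
            γ ∈ AddSubmonoid.closure X ∨ γ ∈ AddSubmonoid.closure Y) →
          γ - b ∈ AddSubmonoid.closure X → b ∈ X ∨ b ∈ Y → γ ∈ AddSubmonoid.closure X := by
        intro X Y hXY ih hX hb
        rcases hb with hb | hb
        · have := AddSubmonoid.add_mem _ hX (AddSubmonoid.subset_closure hb)
          rwa [sub_add_cancel] at this
        · exfalso
          have h0 : ⟪γ - b, b⟫ = 0 := inner_eq_zero_of_mem_closure (fun a ha => hXY a ha b hb) hX
          have hε : γ - b - b ∈ ctx.Δ := sub_mem_of_add_mem (base_mem hbb) h0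
            (by rw [sub_add_cancel]; exact ctx.pos_subset hγ)
          have hεp : γ - b - b ∈ ctx.Pos := by
            rw [sub_sub, ← two_smul ℝ] at hε ⊢
            exact hsub 2 le_rfl hε
          rcases ih _ hεp (by rw [map_sub, height_base hbb]; linarith) with h | h
          · have := inner_eq_zero_of_mem_closure (fun a ha => hXY a ha b hb) h
            rw [inner_sub_left, h0] at this
            linarith [inner_self_pos (base_mem hbb)]
          · have h' := AddSubmonoid.add_mem _ h (AddSubmonoid.subset_closure hb)
            rw [sub_add_cancel] at h'
            have := inner_eq_zero_of_mem_closure (w := γ - b) (fun a ha => by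
              rw [real_inner_comm]
              exact inner_eq_zero_of_mem_closure (fun c hc => hXY c hc a ha) hX) h'
            linarith [inner_self_pos hδ]
      rcases ih _ hδp hδh with h | h
      · exact .inl (step X Y hXY ih h (hb b hbb))
      · exact .inr (step Y X (fun a ha c hc => by rw [real_inner_comm]; exact hXY c hc a ha)
          (fun γ h h' => (ih γ h h').symm) h (hb b hbb).symm)
  obtain ⟨n, hn⟩ := exists_nat_ge (ctx.height γ)
  exact key n γ hγ hn

lemma exists_inner_ne_zero_of_ssubset {X : Finset V} (hX : X ⊆ ctx.base) (hne : X.Nonempty)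
    (h : X ≠ ctx.base) : ∃ a ∈ X, ∃ b ∈ ctx.base, b ∉ X ∧ ⟪a, b⟫ ≠ 0 := by
  by_contra! horth
  have hsplit : ∀ γ ∈ ctx.Pos, γ ∈ AddSubmonoid.closure (X : Set V) ∨
      γ ∈ AddSubmonoid.closure ((ctx.base \ X : Finset V) : Set V) := fun γ hγ =>
    mem_closure_or_mem_closure (fun a ha b hb => horth a ha b (Finset.mem_sdiff.mp hb).1
      (Finset.mem_sdiff.mp hb).2) (fun b hb => by simp [hb, em]) hγ
  let S := ctx.Δ.filter fun γ => ∀ b ∈ ctx.base \ X, ⟪γ, b⟫ = 0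
  have hXS : ∀ γ ∈ AddSubmonoid.closure (X : Set V), ∀ b ∈ ctx.base \ X, ⟪γ, b⟫ = 0 :=
    fun γ hγ b hb => inner_eq_zero_of_mem_closure (fun a ha => horth a ha b
      (Finset.mem_sdiff.mp hb).1 (Finset.mem_sdiff.mp hb).2) hγ
  have hS : S = ctx.Δ := by
    refine ctx.irreducible S (Finset.filter_subset _ _) ?_ fun a ha b hb hbS => ?_
    · obtain ⟨a, ha⟩ := hne
      exact ⟨a, Finset.mem_filter.mpr ⟨base_mem (hX ha),
        hXS a (AddSubmonoid.subset_closure ha)⟩⟩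
    · have hY : ∀ c ∈ AddSubmonoid.closure ((ctx.base \ X : Finset V) : Set V), ⟪a, c⟫ = 0 :=
        fun c hc => by
          rw [real_inner_comm]
          exact inner_eq_zero_of_mem_closure
            (fun y hy => by rw [real_inner_comm]; exact (Finset.mem_filter.mp ha).2 y hy) hc
      rcases ctx.pos_or_neg b hb with hp | hp <;> rcases hsplit _ hp with hc | hc
      · exact absurd (Finset.mem_filter.mpr ⟨hb, hXS b hc⟩) hbS
      · exact hY b hc
      · refine absurd (Finset.mem_filter.mpr ⟨hb, fun y hy => ?_⟩) hbS
        simpa using hXS _ hc y hy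
      · simpa using hY _ hc
  obtain ⟨b, hb, hbX⟩ := Finset.exists_of_ssubset (hX.ssubset_of_ne h)
  have hbS : b ∈ S := hS ▸ base_mem hb
  exact (inner_self_pos (base_mem hb)).ne'
    ((Finset.mem_filter.mp hbS).2 b (Finset.mem_sdiff.mpr ⟨hb, hbX⟩))

lemma exists_int_inner_base {a b : V} (ha : a ∈ ctx.base) (hb : b ∈ ctx.base) (hab : a ≠ b)
    (h : ⟪a, b⟫ ≠ 0) : ∃ m : ℤ, 1 ≤ m ∧ -2 * ⟪a, b⟫ = m * ⟪b, b⟫ := by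
  obtain ⟨k, hk⟩ := ctx.pairing_int b (base_mem hb) a (base_mem ha)
  have e := cartanPairing_mul_inner (base_mem hb) a
  have hbb := inner_self_pos (base_mem hb)
  have hlt := lt_of_le_of_ne (inner_base_nonpos ha hb hab) h
  rw [hk] at e
  refine ⟨-k, ?_, by push_cast; linarith⟩
  have : (k : ℝ) < 0 := by
    by_contra! hk0
    linarith [mul_nonneg hk0 hbb.le]
  have : k < 0 := by exact_mod_cast this
  omega

lemma inner_self_le_of_inner_base_ne_zero {a b : V} (ha : a ∈ ctx.base) (hb : b ∈ ctx.base)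
    (hab : a ≠ b) (h : ⟪a, b⟫ ≠ 0) : ⟪b, b⟫ ≤ -2 * ⟪a, b⟫ := by
  obtain ⟨m, hm, e⟩ := exists_int_inner_base ha hb hab h
  have : (1 : ℝ) ≤ m := by exact_mod_cast hm
  rw [e]
  nlinarith [inner_self_pos (base_mem hb)]

/-- The entries of the Cartan matrix of a type `A` chain. -/
noncomputable def chainEntry (i j : ℕ) : ℝ :=
  if i = j then 2 else if i + 1 = j ∨ j + 1 = i then -1 else 0

variable (ctx) in
/-- A chain `x₀, …, x_{k-1}` of simple roots which together with its image under the cascade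
involution forms a diagram of type `A_{2k}`, folded at `x₀`. -/
structure IsFoldedChain (K : Finset V) (L : ℝ) (k : ℕ) (x : ℕ → V) : Prop where
  mem : ∀ i < k, x i ∈ ctx.base
  inner : ∀ i < k, ∀ j < k, 2 * ⟪x i, x j⟫ = L * chainEntry i j
  inner_inv : ∀ i < k, ∀ j < k,
    2 * ⟪x i, cascInv K (x j)⟫ = L * if i = 0 ∧ j = 0 then -1 else 0

/-- The sum of the first `n` members of a chain and of their images. -/
noncomputable def chainSum (K : Finset V) (x : ℕ → V) (n : ℕ) : V :=
  ∑ i ∈ Finset.range n, (x i + cascInv K (x i))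

variable {K : Finset V} {L : ℝ} {k : ℕ} {x : ℕ → V}

lemma IsFoldedChain.inner_chainSum (hx : ctx.IsFoldedChain K L k x) {n j : ℕ} (hn : n ≤ k)
    (hj : j < k) : 2 * ⟪x j, chainSum K x n⟫ =
      L * if j + 1 = n then 1 else if j = n ∧ 1 ≤ n then -1 else 0 := by
  induction n with
  | zero => simp [chainSum]
  | succ n ih =>
    have e1 := hx.inner j hj n (by omega)
    have e2 := hx.inner_inv j hj n (by omega)
    have e3 := ih (by omega)
    rw [chainSum, Finset.sum_range_succ, ← chainSum, inner_add_right, inner_add_right, mul_add,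
      mul_add, e1, e2, e3, ← mul_add, ← mul_add]
    congr 1
    unfold chainEntry
    split_ifs <;> first | (exfalso; omega) | norm_num

lemma IsCascade.inner_chainSum_left (hK : ctx.IsCascade K) (v : V) (n : ℕ) :
    ⟪v + cascInv K v, chainSum K x n⟫ = ∑ i ∈ Finset.range n, 2 * ⟪v + cascInv K v, x i⟫ := by
  rw [chainSum, inner_sum]
  refine Finset.sum_congr rfl fun i _ => ?_
  simp only [inner_add_left, inner_add_right, hK.inner_cascInv_cascInv]
  rw [inner_cascInv_left]
  ring

lemma IsCascade.inner_chainSum_chainSum (hK : ctx.IsCascade K) (hx : ctx.IsFoldedChain K L k x)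
    {m n : ℕ} (hmn : m ≤ n) (hn : n ≤ k) :
    ⟪chainSum K x m, chainSum K x n⟫ = if m = n ∧ 1 ≤ n then L else 0 := by
  have hinv : ∀ i, ⟪cascInv K (x i), chainSum K x n⟫ = ⟪x i, chainSum K x n⟫ := by
    intro i
    rw [chainSum, inner_sum, inner_sum]
    refine Finset.sum_congr rfl fun j _ => ?_
    rw [inner_add_right, inner_add_right, hK.inner_cascInv_cascInv, inner_cascInv_left, add_comm]
  have : ∀ m ≤ n, ⟪chainSum K x m, chainSum K x n⟫ = if m = n ∧ 1 ≤ n then L else 0 := by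
    intro m
    induction m with
    | zero =>
      intro _
      rw [if_neg (by omega)]
      simp [chainSum]
    | succ m ih =>
      intro h
      have e := hx.inner_chainSum hn (show m < k by omega)
      rw [chainSum, Finset.sum_range_succ, ← chainSum, inner_add_left, inner_add_left, hinv,
        ih (by omega), if_neg (by omega), ← two_mul, e]
      split_ifs <;> first | (exfalso; omega) | norm_num
  exact this m hmn

lemma height_chainSum_nonneg (hK : ctx.IsCascade K) (hx : ctx.IsFoldedChain K L k x) {n : ℕ}
    (hn : n ≤ k) : 0 ≤ ctx.height (chainSum K x n) := by
  rw [chainSum, map_sum]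
  refine Finset.sum_nonneg fun i hi => ?_
  have hi' := hx.mem i ((Finset.mem_range.mp hi).trans_le hn)
  rw [map_add, height_base hi', height_base (hK.cascInv_base hi')]
  norm_num

/-- A strict form of Bessel's inequality for vectors in an open half space. -/
lemma inner_sq_add_inner_sq_lt {f : V →ₗ[ℝ] ℝ} {Z E E' : V} (hL : 0 < L) (hE : ⟪E, E⟫ = L)
    (hE' : ⟪E', E'⟫ ≤ L) (h0 : ⟪E', E⟫ = 0) (hfZ : 0 < f Z) (hfE : 0 ≤ f E) (hfE' : 0 ≤ f E')
    (hs : ⟪Z, E⟫ ≤ 0) (hs' : ⟪Z, E'⟫ ≤ 0) : ⟪Z, E⟫ ^ 2 + ⟪Z, E'⟫ ^ 2 < L * ⟪Z, Z⟫ := by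
  set s := ⟪Z, E⟫ with hsdef
  set s' := ⟪Z, E'⟫ with hsdef'
  set U := L • Z - s • E - s' • E' with hU
  have hne : U ≠ 0 := by
    intro h
    have : f U = 0 := by rw [h, map_zero]
    rw [hU, map_sub, map_sub, map_smul, map_smul, map_smul, smul_eq_mul, smul_eq_mul,
      smul_eq_mul] at this
    nlinarith [mul_pos hL hfZ, mul_nonneg (neg_nonneg.mpr hs) hfE,
      mul_nonneg (neg_nonneg.mpr hs') hfE']
  have hpos : 0 < ⟪U, U⟫ := real_inner_self_pos.mpr hne
  have e : ⟪U, U⟫ = L * (L * ⟪Z, Z⟫ - s ^ 2) - 2 * L * s' ^ 2 + s' ^ 2 * ⟪E', E'⟫ := by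
    have h0' : ⟪E, E'⟫ = 0 := by rw [real_inner_comm, h0]
    simp only [hU, inner_sub_left, inner_sub_right, real_inner_smul_left, real_inner_smul_right,
      real_inner_comm Z E, real_inner_comm Z E', ← hsdef, ← hsdef', h0, h0', hE]
    ring
  have : 0 < L * (L * ⟪Z, Z⟫ - s ^ 2 - s' ^ 2) := by
    nlinarith [mul_le_mul_of_nonneg_left hE' (sq_nonneg s')]
  linarith [pos_of_mul_pos_right this hL.le]

lemma IsFoldedChain.inner_self (hx : ctx.IsFoldedChain K L k x) {i : ℕ} (hi : i < k) :
    ⟪x i, x i⟫ = L := by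
  have := hx.inner i hi i hi
  rw [chainEntry, if_pos rfl] at this
  linarith

lemma IsFoldedChain.extend (hK : ctx.IsCascade K) (hL : 0 < L) (hx : ctx.IsFoldedChain K L k x)
    (hk : 1 ≤ k) {z : V} (hz : z ∈ ctx.base) (hzx : ∀ j < k, z ≠ x j)
    (hzx' : ∀ j < k, cascInv K z ≠ x j) {i : ℕ} (hi : i < k) (hne : ⟪z, x i⟫ ≠ 0) :
    ctx.IsFoldedChain K L (k + 1) (Function.update x k z) := by
  have hLx : ∀ j < k, ⟪x j, x j⟫ = L := fun _ hj => hx.inner_self hj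
  have hz' := hK.cascInv_base hz
  have hN := inner_self_pos (base_mem hz)
  have hlen : ⟪cascInv K z, cascInv K z⟫ = ⟪z, z⟫ := hK.inner_cascInv_cascInv z z
  have hcomm : ⟪cascInv K z, z⟫ = ⟪z, cascInv K z⟫ := real_inner_comm _ _
  have hZZ : ⟪z + cascInv K z, z + cascInv K z⟫ = 2 * ⟪z, z⟫ + 2 * ⟪z, cascInv K z⟫ := by
    simp only [inner_add_left, inner_add_right]
    linarith
  have hz0 : ∀ j < k, ⟪z, x j⟫ ≤ 0 := fun j hj => inner_base_nonpos hz (hx.mem j hj) (hzx j hj)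
  have hz0' : ∀ j < k, ⟪cascInv K z, x j⟫ ≤ 0 := fun j hj =>
    inner_base_nonpos hz' (hx.mem j hj) (hzx' j hj)
  have hgap : ∀ j < k, ⟪z, x j⟫ ≠ 0 → L ≤ -2 * ⟪z, x j⟫ := fun j hj h =>
    hLx j hj ▸ inner_self_le_of_inner_base_ne_zero hz (hx.mem j hj) (hzx j hj) h
  have hgap' : ∀ j < k, ⟪cascInv K z, x j⟫ ≠ 0 → L ≤ -2 * ⟪cascInv K z, x j⟫ := fun j hj h =>
    hLx j hj ▸ inner_self_le_of_inner_base_ne_zero hz' (hx.mem j hj) (hzx' j hj) h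
  have hsum_le : ∀ w, (∀ j < k, ⟪w, x j⟫ ≤ 0) → ∀ n ≤ k, ∀ j < n,
      ∑ l ∈ Finset.range n, ⟪w, x l⟫ ≤ ⟪w, x j⟫ := by
    intro w hw n hn j hj
    have := Finset.single_le_sum (f := fun l => -⟪w, x l⟫) (fun l hl =>
      neg_nonneg.mpr (hw l ((Finset.mem_range.mp hl).trans_le hn))) (Finset.mem_range.mpr hj)
    rw [Finset.sum_neg_distrib] at this
    linarith
  have hsum0 : ∀ w, (∀ j < k, ⟪w, x j⟫ ≤ 0) → ∀ n ≤ k, ∑ l ∈ Finset.range n, ⟪w, x l⟫ ≤ 0 :=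
    fun w hw n hn => Finset.sum_nonpos fun l hl => hw l ((Finset.mem_range.mp hl).trans_le hn)
  have hZE : ∀ n, ⟪z + cascInv K z, chainSum K x n⟫ =
      2 * ∑ l ∈ Finset.range n, ⟪z, x l⟫ + 2 * ∑ l ∈ Finset.range n, ⟪cascInv K z, x l⟫ := by
    intro n
    rw [hK.inner_chainSum_left, Finset.mul_sum, Finset.mul_sum, ← Finset.sum_add_distrib]
    exact Finset.sum_congr rfl fun l _ => by rw [inner_add_left, mul_add]
  have hbessel := inner_sq_add_inner_sq_lt (f := ctx.height) (Z := z + cascInv K z)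
    (E := chainSum K x k) (E' := chainSum K x (k - 1)) hL
    (by rw [hK.inner_chainSum_chainSum hx le_rfl le_rfl, if_pos ⟨rfl, hk⟩])
    (by rw [hK.inner_chainSum_chainSum hx le_rfl (by omega)]; split_ifs <;> linarith)
    (by rw [hK.inner_chainSum_chainSum hx (by omega) le_rfl, if_neg (by omega)])
    (by rw [map_add, height_base hz, height_base hz']; norm_num)
    (height_chainSum_nonneg hK hx le_rfl) (height_chainSum_nonneg hK hx (by omega))
    (by rw [hZE]; linarith [hsum0 z hz0 k le_rfl, hsum0 _ hz0' k le_rfl])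
    (by rw [hZE]; linarith [hsum0 z hz0 (k - 1) (by omega), hsum0 _ hz0' (k - 1) (by omega)])
  rw [hZZ, hZE, hZE] at hbessel
  set A := ∑ l ∈ Finset.range k, ⟪z, x l⟫
  set B := ∑ l ∈ Finset.range k, ⟪cascInv K z, x l⟫
  set A' := ∑ l ∈ Finset.range (k - 1), ⟪z, x l⟫
  set B' := ∑ l ∈ Finset.range (k - 1), ⟪cascInv K z, x l⟫
  have hAi : A ≤ ⟪z, x i⟫ := hsum_le z hz0 k le_rfl i hi
  have hB0 : B ≤ 0 := hsum0 _ hz0' k le_rfl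
  have hB0' : B' ≤ 0 := hsum0 _ hz0' (k - 1) (by omega)
  obtain ⟨m, hm1, hm⟩ := exists_int_inner_base hz (hx.mem i hi) (hzx i hi) hne
  obtain ⟨n, hn1, hn⟩ := exists_int_inner_base (hx.mem i hi) hz (hzx i hi).symm
    (by rwa [real_inner_comm])
  rw [hLx i hi] at hm
  rw [real_inner_comm] at hn
  have hm1' : (1 : ℝ) ≤ m := by exact_mod_cast hm1
  have hn1' : (1 : ℝ) ≤ n := by exact_mod_cast hn1
  have hNle : ⟪z, z⟫ ≤ -2 * ⟪z, x i⟫ := by nlinarith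
  have hLle : L ≤ -2 * ⟪z, x i⟫ := by nlinarith
  have hsq : ∀ {r s : ℝ}, 0 ≤ r → s ≤ -r → r ^ 2 ≤ s ^ 2 := fun hr hs => by nlinarith
  have hfix : cascInv K z ≠ z := by
    intro h
    have hBA : B = A := by simp only [A, B, h]
    rw [hBA, h] at hbessel
    have := hsq (r := -4 * ⟪z, x i⟫) (s := 2 * A + 2 * A) (by linarith) (by linarith)
    nlinarith [mul_le_mul hLle hNle hN.le (by linarith), sq_nonneg (2 * A' + 2 * B')]
  have hzz' : ⟪z, cascInv K z⟫ ≤ 0 := inner_base_nonpos hz hz' hfix.symm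
  have hmn : m * n < 2 := by
    have := hsq (r := -2 * ⟪z, x i⟫) (s := 2 * A + 2 * B) (by linarith) (by linarith)
    have h1 : (-2 * ⟪z, x i⟫) * (-2 * ⟪z, x i⟫) < 2 * (L * ⟪z, z⟫) := by
      nlinarith [sq_nonneg (2 * A' + 2 * B'), mul_nonneg hL.le (neg_nonneg.mpr hzz')]
    have h2 : (m * n : ℝ) < 2 := by
      have e : (-2 * ⟪z, x i⟫) * (-2 * ⟪z, x i⟫) = (m * n) * (L * ⟪z, z⟫) := by
        nth_rewrite 1 [hm]
        rw [hn]
        ring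
      rw [e] at h1
      exact lt_of_mul_lt_mul_right h1 (mul_pos hL hN).le
    exact_mod_cast h2
  obtain rfl : m = 1 := by nlinarith
  obtain rfl : n = 1 := by nlinarith
  rw [Int.cast_one, one_mul] at hm hn
  have hNL : ⟪z, z⟫ = L := hn.symm.trans hm
  have horth : ⟪z, cascInv K z⟫ = 0 := by
    by_contra h
    have h1 := inner_self_le_of_inner_base_ne_zero hz hz' hfix.symm h
    rw [hlen, hNL] at h1
    have := hsq (r := L) (s := 2 * A + 2 * B) hL.le (by linarith)
    nlinarith [sq_nonneg (2 * A' + 2 * B')]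
  rw [horth, hNL] at hbessel
  have hz'x : ∀ j < k, ⟪cascInv K z, x j⟫ = 0 := by
    intro j hj
    by_contra h
    have h1 := hgap' j hj h
    have h2 : B ≤ ⟪cascInv K z, x j⟫ := hsum_le _ hz0' k le_rfl j hj
    have := hsq (r := 2 * L) (s := 2 * A + 2 * B) (by linarith) (by linarith)
    nlinarith [sq_nonneg (2 * A' + 2 * B')]
  have hzj : ∀ j < k, j + 1 ≠ k → ⟪z, x j⟫ = 0 := by
    intro j hj hjk
    by_contra h
    have h1 := hgap j hj h
    have h2 : A ≤ ⟪z, x j⟫ := hsum_le _ hz0 k le_rfl j hj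
    have h3 : A' ≤ ⟪z, x j⟫ := hsum_le _ hz0 (k - 1) (by omega) j (by omega)
    have := hsq (r := L) (s := 2 * A + 2 * B) hL.le (by linarith)
    have := hsq (r := L) (s := 2 * A' + 2 * B') hL.le (by linarith)
    nlinarith
  have hik : i + 1 = k := by
    by_contra h
    exact hne (hzj i hi h)
  have hzx2 : ∀ j < k, 2 * ⟪z, x j⟫ = L * chainEntry j k := by
    intro j hj
    by_cases h : j + 1 = k
    · obtain rfl : j = i := by omega
      rw [chainEntry, if_neg (by omega), if_pos (.inl h)]
      linarith
    · rw [hzj j hj h, chainEntry, if_neg (by omega), if_neg (by omega)]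
      ring
  have hsymm : ∀ i j, chainEntry i j = chainEntry j i := by
    intro i j
    simp only [chainEntry, eq_comm, or_comm]
  have hup : ∀ j < k, Function.update x k z j = x j := fun j hj =>
    Function.update_of_ne hj.ne _ _
  have hupk : Function.update x k z k = z := Function.update_self ..
  refine ⟨fun j hj => ?_, fun a ha b hb => ?_, fun a ha b hb => ?_⟩
  · rcases Nat.lt_succ_iff_lt_or_eq.mp hj with hj | rfl
    · rw [hup j hj]
      exact hx.mem j hj
    · rwa [hupk]
  · rcases Nat.lt_succ_iff_lt_or_eq.mp ha with ha | rfl <;>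
      rcases Nat.lt_succ_iff_lt_or_eq.mp hb with hb | rfl
    · rw [hup a ha, hup b hb, hx.inner a ha b hb]
    · rw [hup a ha, hupk, real_inner_comm, hzx2 a ha]
    · rw [hupk, hup b hb, hzx2 b hb, hsymm]
    · rw [hupk, hNL, chainEntry, if_pos rfl, mul_comm]
  · rcases Nat.lt_succ_iff_lt_or_eq.mp ha with ha | rfl <;>
      rcases Nat.lt_succ_iff_lt_or_eq.mp hb with hb | rfl
    · rw [hup a ha, hup b hb, hx.inner_inv a ha b hb]
    · rw [hup a ha, hupk, real_inner_comm, hz'x a ha, if_neg (by omega)]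
      ring
    · rw [hupk, hup b hb, ← inner_cascInv_left, hz'x b hb, if_neg (by omega)]
      ring
    · rw [hupk, horth, if_neg (by omega)]
      ring

lemma eq_of_chainEntry_eq_two {i j : ℕ} (h : chainEntry i j = 2) : i = j := by
  by_contra hij
  rw [chainEntry, if_neg hij] at h
  split_ifs at h <;> norm_num at h

lemma IsFoldedChain.le_card (hL : 0 < L) (hx : ctx.IsFoldedChain K L k x) :
    k ≤ ctx.base.card := by
  rw [← Finset.card_range k]
  refine Finset.card_le_card_of_injOn x (fun i hi => hx.mem i (Finset.mem_range.mp hi))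
    fun i hi j hj hij => ?_
  have h := hx.inner i (Finset.mem_range.mp hi) j (Finset.mem_range.mp hj)
  rw [← hij, hx.inner_self (Finset.mem_range.mp hi), mul_comm] at h
  exact eq_of_chainEntry_eq_two (mul_left_cancel₀ hL.ne' h).symm

/-- The linear order on the diagram formed by a folded chain and its image. -/
noncomputable def unfold (K : Finset V) (k : ℕ) (x : ℕ → V) (n : ℕ) : V :=
  if n < k then cascInv K (x (k - 1 - n)) else x (n - k)

lemma IsFoldedChain.inner_unfold (hK : ctx.IsCascade K) (hx : ctx.IsFoldedChain K L k x)
    {i j : ℕ} (hi : i < 2 * k) (hj : j < 2 * k) :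
    2 * ⟪unfold K k x i, unfold K k x j⟫ = L * chainEntry i j := by
  unfold unfold
  split_ifs with h1 h2 h2
  · rw [hK.inner_cascInv_cascInv, hx.inner _ (by omega) _ (by omega)]
    congr 1
    unfold chainEntry
    split_ifs <;> first | rfl | (exfalso; omega)
  · rw [inner_cascInv_left, hx.inner_inv _ (by omega) _ (by omega)]
    congr 1
    unfold chainEntry
    split_ifs <;> first | rfl | (exfalso; omega)
  · rw [hx.inner_inv _ (by omega) _ (by omega)]
    congr 1
    unfold chainEntry
    split_ifs <;> first | rfl | (exfalso; omega)
  · rw [hx.inner _ (by omega) _ (by omega)]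
    congr 1
    unfold chainEntry
    split_ifs <;> first | rfl | (exfalso; omega)

lemma IsFoldedChain.isTypeA (hK : ctx.IsCascade K) (hL : 0 < L) (hx : ctx.IsFoldedChain K L k x)
    (hk : 1 ≤ k) (hsurj : ∀ b ∈ ctx.base, ∃ i < k, b = x i ∨ b = cascInv K (x i)) :
    ctx.IsTypeA (2 * k) := by
  have hmem : ∀ n < 2 * k, unfold K k x n ∈ ctx.base := by
    intro n hn
    unfold unfold
    split_ifs
    · exact hK.cascInv_base (hx.mem _ (by omega))
    · exact hx.mem _ (by omega)
  have hself : ∀ n < 2 * k, ⟪unfold K k x n, unfold K k x n⟫ = L := by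
    intro n hn
    have := hx.inner_unfold hK hn hn
    rw [chainEntry, if_pos rfl] at this
    linarith
  let e : Fin (2 * k) → {b // b ∈ ctx.base} := fun n => ⟨unfold K k x n, hmem n n.2⟩
  have he : Function.Bijective e := by
    constructor
    · intro i j hij
      have hij' : unfold K k x i = unfold K k x j := congrArg Subtype.val hij
      have h := hx.inner_unfold hK i.2 j.2
      rw [← hij', hself i i.2, mul_comm] at h
      exact Fin.ext (eq_of_chainEntry_eq_two (mul_left_cancel₀ hL.ne' h).symm)
    · rintro ⟨b, hb⟩
      obtain ⟨i, hi, rfl | rfl⟩ := hsurj b hb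
      · refine ⟨⟨k + i, by omega⟩, Subtype.ext ?_⟩
        simp [e, unfold]
      · refine ⟨⟨k - 1 - i, by omega⟩, Subtype.ext ?_⟩
        have h1 : k - 1 - i < k := by omega
        have h2 : k - 1 - (k - 1 - i) = i := by omega
        simp [e, unfold, h1, h2]
  refine ⟨by omega, Equiv.ofBijective e he, fun i j => ?_⟩
  simp only [Equiv.ofBijective_apply, e, cartanPairing]
  rw [hx.inner_unfold hK i.2 j.2, hself j j.2, mul_div_cancel_left₀ _ hL.ne', chainEntry]
  simp only [Fin.ext_iff]

/-- A simple root that is moved to a non-orthogonal one by the cascade involution exists only in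
type `A` of even rank. -/
lemma IsCascade.exists_isTypeA (hK : ctx.IsCascade K) {α : V} (hα : α ∈ ctx.base)
    (hne : cascInv K α ≠ α) (hno : ⟪cascInv K α, α⟫ ≠ 0) :
    ∃ p, 1 ≤ p ∧ ctx.IsTypeA (2 * p) := by
  set L := ⟪α, α⟫ with hLdef
  have hL : 0 < L := inner_self_pos (base_mem hα)
  have hα' := hK.cascInv_base hα
  have h1 : ctx.IsFoldedChain K L 1 fun _ => α := by
    refine ⟨fun _ _ => hα, fun i hi j hj => ?_, fun i hi j hj => ?_⟩
    · rw [chainEntry, if_pos (by omega), mul_comm]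
    · rw [if_pos (by omega), real_inner_comm]
      obtain ⟨m, hm, e⟩ := exists_int_inner_base hα' hα hne hno
      have hpos : 0 < ⟪cascInv K α + α, cascInv K α + α⟫ := by
        refine real_inner_self_pos.mpr fun h => ?_
        have := congrArg ctx.height h
        rw [map_add, height_base hα, height_base hα', map_zero] at this
        norm_num at this
      have hLL : ⟪cascInv K α, cascInv K α⟫ = L := hK.inner_cascInv_cascInv α α
      rw [inner_add_left, inner_add_right, inner_add_right, hLL, real_inner_comm (cascInv K α) α,
        ← hLdef] at hpos
      rw [← hLdef] at e
      have hm2 : (m : ℝ) < 2 := by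
        refine lt_of_mul_lt_mul_right ?_ hL.le
        linarith
      obtain rfl : m = 1 := by
        have : m < 2 := by exact_mod_cast hm2
        omega
      rw [Int.cast_one] at e
      linarith
  obtain ⟨k, hk, ⟨x, hx⟩, hmax⟩ : ∃ k, 1 ≤ k ∧ (∃ x, ctx.IsFoldedChain K L k x) ∧
      ¬ ∃ x, ctx.IsFoldedChain K L (k + 1) x := by
    by_contra! h
    have hall : ∀ k, 1 ≤ k → ∃ x, ctx.IsFoldedChain K L k x := fun k hk =>
      Nat.le_induction ⟨_, h1⟩ h k hk
    obtain ⟨x, hx⟩ := hall (ctx.base.card + 1) (by omega)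
    have := hx.le_card hL
    omega
  refine ⟨k, hk, hx.isTypeA hK hL hk ?_⟩
  let X : Finset V := ctx.base.filter fun b => ∃ i < k, b = x i ∨ b = cascInv K (x i)
  suffices X = ctx.base by
    intro b hb
    rw [← this] at hb
    exact (Finset.mem_filter.mp hb).2
  by_contra hX
  obtain ⟨a, ha, b, hb, hbX, hab⟩ := exists_inner_ne_zero_of_ssubset (Finset.filter_subset _ _)
    ⟨x 0, Finset.mem_filter.mpr ⟨hx.mem 0 hk, 0, hk, .inl rfl⟩⟩ hX
  have hbx : ∀ i < k, b ≠ x i := fun i hi h =>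
    hbX (Finset.mem_filter.mpr ⟨hb, i, hi, .inl h⟩)
  have hbx' : ∀ i < k, cascInv K b ≠ x i := fun i hi h =>
    hbX (Finset.mem_filter.mpr ⟨hb, i, hi, .inr (by rw [← h, hK.cascInv_cascInv])⟩)
  obtain ⟨-, i, hi, rfl | rfl⟩ := Finset.mem_filter.mp ha
  · exact hmax ⟨_, hx.extend hK hL hk hb hbx hbx' hi (by rwa [real_inner_comm])⟩
  · refine hmax ⟨_, hx.extend hK hL hk (hK.cascInv_base hb) hbx' ?_ hi ?_⟩
    · simpa only [hK.cascInv_cascInv] using hbx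
    · rwa [inner_cascInv_left, real_inner_comm] at hab
end TypeA

end RootSystemCtx

namespace LieRootData

variable {V : Type*} [NormedAddCommGroup V] [InnerProductSpace ℝ V] {ctx : RootSystemCtx V}
  {g : Type*} [LieRing g] [LieAlgebra ℂ g]

lemma two_smul_notMem (d : LieRootData ctx g) {γ : V} (hγ : γ ∈ ctx.Δ) : (2 : ℝ) • γ ∉ ctx.Δ := by
  intro h
  rw [two_smul] at h
  obtain ⟨c, hc, e⟩ := d.bracket_e_e_root γ hγ γ hγ h
  rw [lie_self] at e
  exact smul_ne_zero hc (d.e_ne _ h) e.symm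

variable [FiniteDimensional ℂ g]

lemma finrank_span_roots_and_disjoint (d : LieRootData ctx g) :
    Module.finrank ℂ (Submodule.span ℂ (d.e '' (ctx.Δ : Set V))) = ctx.Δ.card ∧
    Disjoint d.t.toSubmodule (Submodule.span ℂ (d.e '' (ctx.Δ : Set V))) := by
  have h1 : Module.finrank ℂ (Submodule.span ℂ (d.e '' (ctx.Δ : Set V))) ≤ ctx.Δ.card := by
    rw [← Finset.coe_image]
    exact (finrank_span_finset_le_card _).trans Finset.card_image_le
  have h2 := Submodule.finrank_sup_add_finrank_inf_eq d.t.toSubmodule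
    (Submodule.span ℂ (d.e '' (ctx.Δ : Set V)))
  rw [← d.span_top, finrank_top, d.dim_eq] at h2
  have h3 : Module.finrank ℂ d.t.toSubmodule = Module.finrank ℂ d.t := rfl
  refine ⟨by omega, disjoint_iff.mpr (Submodule.finrank_eq_zero.mp (by omega))⟩

lemma linearIndepOn_roots (d : LieRootData ctx g) :
    LinearIndepOn ℂ d.e (ctx.Δ : Set V) := by
  rw [LinearIndepOn, linearIndependent_iff_card_eq_finrank_span, Set.finrank, Set.range_comp',
    Subtype.range_coe, d.finrank_span_roots_and_disjoint.1]
  simp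

lemma finrank_span (d : LieRootData ctx g) {A : Finset V} (hA : A ⊆ ctx.Δ) :
    Module.finrank ℂ (Submodule.span ℂ (d.e '' (A : Set V))) = A.card := by
  have h := d.linearIndepOn_roots.mono (Finset.coe_subset.mpr hA)
  rw [LinearIndepOn, linearIndependent_iff_card_eq_finrank_span, Set.finrank, Set.range_comp',
    Subtype.range_coe] at h
  simpa using h.symm

lemma finrank_sup_span (d : LieRootData ctx g) {A : Finset V} (hA : A ⊆ ctx.Δ) :
    Module.finrank ℂ ↥(d.t.toSubmodule ⊔ Submodule.span ℂ (d.e '' (A : Set V))) =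
      Module.finrank ℂ d.t + A.card := by
  have h2 := Submodule.finrank_sup_add_finrank_inf_eq d.t.toSubmodule
    (Submodule.span ℂ (d.e '' (A : Set V)))
  have h3 := d.finrank_span_roots_and_disjoint.2.mono_right
    (Submodule.span_mono (Set.image_mono (Finset.coe_subset.mpr hA)))
  rw [disjoint_iff.mp h3, finrank_bot, d.finrank_span hA, add_zero] at h2
  exact h2

end LieRootData

/-- The `ℤ₂`-grading `g = g₀ ⊕ g₁` determined by the parity of `γ(x_K)` satisfies
`dim g₀ = dim b - #K` and `dim g₁ = dim u⁺ + #K`. -/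
theorem involution_eigenspace_dims {V : Type*} [NormedAddCommGroup V] [InnerProductSpace ℝ V]
    [FiniteDimensional ℝ V] (ctx : RootSystemCtx V)
    {g : Type*} [LieRing g] [LieAlgebra ℂ g] [FiniteDimensional ℂ g]
    (d : LieRootData ctx g)
    (K : Finset V) (hK : ctx.IsCascade K)
    (hA : ¬ ∃ p, 1 ≤ p ∧ ctx.IsTypeA (2 * p)) :
    ∀ g0 g1 u b : Submodule ℂ g,
      g0 = d.t.toSubmodule ⊔ Submodule.span ℂ
        (d.e '' {γ | γ ∈ ctx.Δ ∧ ∃ k : ℤ, Even k ∧ ⟪γ, cascElt K⟫ = (k : ℝ)}) →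
      g1 = Submodule.span ℂ
        (d.e '' {γ | γ ∈ ctx.Δ ∧ ∃ k : ℤ, Odd k ∧ ⟪γ, cascElt K⟫ = (k : ℝ)}) →
      u = Submodule.span ℂ (d.e '' (ctx.Pos : Set V)) →
      b = d.t.toSubmodule ⊔ u →
      Module.finrank ℂ ↥g0 + K.card = Module.finrank ℂ ↥b ∧
      Module.finrank ℂ ↥g1 = Module.finrank ℂ ↥u + K.card := by
  rintro g0 g1 u b rfl rfl rfl rfl
  have hint : ∀ α ∈ ctx.base, ∃ k : ℤ, ⟪α, cascElt K⟫ = k := by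
    intro α hα
    have h : RootSystemCtx.cascInv K α = α ∨ ⟪RootSystemCtx.cascInv K α, α⟫ = 0 := by
      by_contra! h
      exact hA (hK.exists_isTypeA hα h.1 h.2)
    obtain ⟨k, hk⟩ := hK.even_sum_cartanPairing (fun γ hγ => d.two_smul_notMem hγ) hα h
    exact ⟨k, by rw [RootSystemCtx.inner_cascElt, hk, mul_div_cancel_left₀ _ two_ne_zero]⟩
  obtain ⟨h0, h1⟩ := hK.card_parity hint
  have coe_filter : ∀ p : V → Prop, {γ | γ ∈ ctx.Δ ∧ p γ} = ((ctx.Δ.filter p : Finset V) : Set V) :=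
    fun p => (Finset.coe_filter p _).symm
  rw [coe_filter, coe_filter, d.finrank_sup_span (Finset.filter_subset _ _),
    d.finrank_span (Finset.filter_subset _ _), d.finrank_sup_span ctx.pos_subset,
    d.finrank_span ctx.pos_subset]
  exact ⟨by rw [← h0, add_assoc], h1⟩
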